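/- Let Kₙ(t; Φ) := ∫_{−∞}^{∞} Φ(s+t)·Φ(s−t)·s^{2n} ds for n ∈ ℕ₀, and let F(x) := ∫_{−∞}^{∞} Φ(t)·e^{ixt} dt = 2H(x), where H(x) := ∫_{0}^{∞} Φ(t)·cos(xt) dt. Then for every n ∈ ℕ₀ and x ∈ ℝ: Lₙ(x; F) = (2·2^{2n}/(2n)!)·∫_{−∞}^{∞} Kₙ(t; Φ)·cos(2xt) dt. Moreover, H has only real zeros (i.e. H belongs to the Laguerre–Pólya class; equivalently, the Riemann Hypothesis holds) if and only if Kₙ(·; Φ) is a positive definite kernel for every n ∈ ℕ₀. -/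

import Mathlib

open ComplexOrder

/-- A continuous function `φ : ℝ → ℝ` is positive definite if every Hermitian form
`∑ⱼ∑ₖ φ(xⱼ − xₖ)·ρⱼ·conj(ρₖ)` is a nonnegative real number. -/
def PosDefKernel (φ : ℝ → ℝ) : Prop :=
  Continuous φ ∧ ∀ (n : ℕ) (x : Fin n → ℝ) (ρ : Fin n → ℂ),
    0 ≤ ∑ j, ∑ k, (φ (x j - x k) : ℂ) * ρ j * (starRingEnd ℂ) (ρ k)

/-- The Jacobi theta kernel `Φ(t) := ∑_{n=1}^∞ π n² (2π n² e^{4t} − 3)·exp(5t − π n² e^{4t})`. -/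
noncomputable def jacobiPhi (t : ℝ) : ℝ :=
  ∑' n : ℕ, Real.pi * ((n : ℝ) + 1) ^ 2 *
    (2 * Real.pi * ((n : ℝ) + 1) ^ 2 * Real.exp (4 * t) - 3) *
    Real.exp (5 * t - Real.pi * ((n : ℝ) + 1) ^ 2 * Real.exp (4 * t))

/-- The associated kernel `Kₙ(t; Φ) := ∫ Φ(s+t)·Φ(s−t)·s^{2n} ds`. -/
noncomputable def assocKernelPhi (n : ℕ) (t : ℝ) : ℝ :=
  ∫ s : ℝ, jacobiPhi (s + t) * jacobiPhi (s - t) * s ^ (2 * n)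

/-- `F(z) := ∫ Φ(t)·e^{izt} dt` (entire extension). -/
noncomputable def fourierPhi (z : ℂ) : ℂ :=
  ∫ t : ℝ, (jacobiPhi t : ℂ) * Complex.exp (Complex.I * z * t)

/-- `H(z) := ∫₀^∞ Φ(t)·cos(zt) dt` (entire extension of the Riemann ξ-function
`H(x) = ξ(x/2)/8`). -/
noncomputable def xiH (z : ℂ) : ℂ :=
  ∫ t in Set.Ioi (0 : ℝ), (jacobiPhi t : ℂ) * Complex.cos (z * t)

/-- The `n`-th generalized Laguerre expression
`Lₙ(x; f) := ∑_{j=0}^{2n} ((−1)^{j+n}/(2n)!)·C(2n,j)·f^{(j)}(x)·f^{(2n−j)}(x)`. -/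
noncomputable def Lag (f : ℂ → ℂ) (n : ℕ) (x : ℂ) : ℂ :=
  ∑ j ∈ Finset.range (2 * n + 1),
    (-1 : ℂ) ^ (j + n) / (Nat.factorial (2 * n)) * (Nat.choose (2 * n) j) *
      iteratedDeriv j f x * iteratedDeriv (2 * n - j) f x

section PartA

/-! ### Part 1: the kernel `Φ` -/

noncomputable def thA (n : ℕ) : ℝ := Real.pi * ((n : ℝ) + 1) ^ 2

lemma thA_pos (n : ℕ) : 0 < thA n := by unfold thA; positivity

lemma thA_ge (n : ℕ) : Real.pi ≤ thA n := by
  unfold thA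
  have h : (1 : ℝ) ≤ ((n : ℝ) + 1) ^ 2 := by
    have : (0 : ℝ) ≤ n := Nat.cast_nonneg n
    nlinarith
  nlinarith [Real.pi_pos]

lemma summable_thA (k : ℕ) {b : ℝ} (hb : 0 < b) :
    Summable fun n => thA n ^ k * Real.exp (-(thA n * b)) := by
  have h := Real.summable_pow_mul_exp_neg_nat_mul k (r := Real.pi * b) (by positivity)
  have hi : Function.Injective (fun n : ℕ => (n + 1) ^ 2) := by
    intro m n h
    simpa using h
  have h2 := (h.comp_injective hi).mul_left (Real.pi ^ k)
  refine h2.congr fun n => ?_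
  simp only [Function.comp, thA]
  push_cast
  rw [mul_pow, mul_assoc]
  congr 3
  ring

noncomputable def thF (n : ℕ) (t : ℝ) : ℝ := Real.exp (t - thA n * Real.exp (4 * t))
noncomputable def thG (n : ℕ) (t : ℝ) : ℝ := (1 - 4 * thA n * Real.exp (4 * t)) * thF n t
noncomputable def thK (n : ℕ) (t : ℝ) : ℝ :=
  (1 - 24 * thA n * Real.exp (4 * t) + 16 * (thA n * Real.exp (4 * t)) ^ 2) * thF n t

lemma hasDerivAt_thF (n : ℕ) (t : ℝ) : HasDerivAt (thF n) (thG n t) t := by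
  unfold thG thF
  have h : HasDerivAt (fun t : ℝ => t - thA n * Real.exp (4 * t))
      (1 - thA n * (Real.exp (4 * t) * (4 * 1))) t :=
    (hasDerivAt_id t).sub ((((hasDerivAt_id t).const_mul 4).exp).const_mul _)
  convert h.exp using 1
  ring

lemma hasDerivAt_thG (n : ℕ) (t : ℝ) : HasDerivAt (thG n) (thK n t) t := by
  have h : HasDerivAt (fun t : ℝ => 1 - 4 * thA n * Real.exp (4 * t))
      (0 - 4 * thA n * (Real.exp (4 * t) * (4 * 1))) t :=
    (hasDerivAt_const t 1).sub ((((hasDerivAt_id t).const_mul 4).exp).const_mul _)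
  refine (h.mul (hasDerivAt_thF n t)).congr_deriv ?_
  unfold thK thG
  ring

noncomputable def thU (T : ℝ) (n : ℕ) : ℝ :=
  (1 + 24 * thA n * Real.exp (4 * T) + 16 * (thA n * Real.exp (4 * T)) ^ 2) *
    (Real.exp T * Real.exp (-(thA n * Real.exp (-(4 * T)))))

lemma summable_thU (T : ℝ) : Summable (thU T) := by
  have h := fun k => summable_thA k (b := Real.exp (-(4 * T))) (Real.exp_pos _)
  have := (((h 0).mul_left (Real.exp T)).add
    ((h 1).mul_left (24 * Real.exp (4 * T) * Real.exp T))).add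
    ((h 2).mul_left (16 * Real.exp (4 * T) ^ 2 * Real.exp T))
  refine this.congr fun n => ?_
  unfold thU
  ring

lemma thF_le {T t : ℝ} (ht : t ∈ Set.Ioo (-T) T) (n : ℕ) :
    thF n t ≤ Real.exp T * Real.exp (-(thA n * Real.exp (-(4 * T)))) := by
  unfold thF
  rw [← Real.exp_add]
  apply Real.exp_le_exp.2
  have h1 : Real.exp (-(4 * T)) ≤ Real.exp (4 * t) := Real.exp_le_exp.2 (by linarith [ht.1])
  have := mul_le_mul_of_nonneg_left h1 (thA_pos n).le
  linarith [ht.2]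

lemma thX_le {T t : ℝ} (ht : t ∈ Set.Ioo (-T) T) (n : ℕ) :
    thA n * Real.exp (4 * t) ≤ thA n * Real.exp (4 * T) := by
  have h1 : Real.exp (4 * t) ≤ Real.exp (4 * T) := Real.exp_le_exp.2 (by linarith [ht.2])
  exact mul_le_mul_of_nonneg_left h1 (thA_pos n).le

lemma thK_le {T t : ℝ} (ht : t ∈ Set.Ioo (-T) T) (n : ℕ) : ‖thK n t‖ ≤ thU T n := by
  have hF : 0 < thF n t := Real.exp_pos _
  unfold thK thU
  rw [norm_mul, Real.norm_of_nonneg hF.le]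
  have hx := thX_le ht n
  have hx0 : 0 < thA n * Real.exp (4 * t) := mul_pos (thA_pos n) (Real.exp_pos _)
  refine mul_le_mul ?_ (thF_le ht n) hF.le (by nlinarith)
  rw [Real.norm_eq_abs, abs_le]
  constructor <;> nlinarith

lemma thG_le {T t : ℝ} (ht : t ∈ Set.Ioo (-T) T) (n : ℕ) : ‖thG n t‖ ≤ thU T n := by
  have hF : 0 < thF n t := Real.exp_pos _
  unfold thG thU
  rw [norm_mul, Real.norm_of_nonneg hF.le]
  have hx := thX_le ht n
  have hx0 : 0 < thA n * Real.exp (4 * t) := mul_pos (thA_pos n) (Real.exp_pos _)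
  refine mul_le_mul ?_ (thF_le ht n) hF.le (by nlinarith)
  rw [Real.norm_eq_abs, abs_le]
  constructor <;> nlinarith

lemma thFn_le {T t : ℝ} (ht : t ∈ Set.Ioo (-T) T) (n : ℕ) : ‖thF n t‖ ≤ thU T n := by
  have hF : 0 < thF n t := Real.exp_pos _
  unfold thU
  rw [Real.norm_of_nonneg hF.le, ← one_mul (thF n t)]
  have hx := thX_le ht n
  have hx0 : 0 < thA n * Real.exp (4 * t) := mul_pos (thA_pos n) (Real.exp_pos _)
  refine mul_le_mul ?_ (thF_le ht n) hF.le (by nlinarith)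
  nlinarith

lemma mem_T (t : ℝ) : t ∈ Set.Ioo (-(|t| + 1)) (|t| + 1) :=
  ⟨by linarith [neg_abs_le t], by linarith [le_abs_self t]⟩

lemma summable_thF (t : ℝ) : Summable fun n => thF n t :=
  Summable.of_norm_bounded (summable_thU _) fun n => thFn_le (mem_T t) n
lemma summable_thG (t : ℝ) : Summable fun n => thG n t :=
  Summable.of_norm_bounded (summable_thU _) fun n => thG_le (mem_T t) n
lemma summable_thK (t : ℝ) : Summable fun n => thK n t :=
  Summable.of_norm_bounded (summable_thU _) fun n => thK_le (mem_T t) n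

lemma hasDerivAt_sF (t : ℝ) : HasDerivAt (fun t => ∑' n, thF n t) (∑' n, thG n t) t :=
  hasDerivAt_tsum_of_isPreconnected (summable_thU (|t| + 1)) isOpen_Ioo isPreconnected_Ioo
    (fun n _ _ => hasDerivAt_thF n _) (fun n _ hy => thG_le hy n) (mem_T t) (summable_thF t)
    (mem_T t)

lemma hasDerivAt_sG (t : ℝ) : HasDerivAt (fun t => ∑' n, thG n t) (∑' n, thK n t) t :=
  hasDerivAt_tsum_of_isPreconnected (summable_thU (|t| + 1)) isOpen_Ioo isPreconnected_Ioo
    (fun n _ _ => hasDerivAt_thG n _) (fun n _ hy => thK_le hy n) (mem_T t) (summable_thG t)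
    (mem_T t)

lemma continuous_sK : Continuous (fun t => ∑' n, thK n t) := by
  rw [continuous_iff_continuousAt]
  intro t
  refine ContinuousOn.continuousAt (s := Set.Ioo (-(|t| + 1)) (|t| + 1)) ?_
    (isOpen_Ioo.mem_nhds (mem_T t))
  refine continuousOn_tsum (fun n => Continuous.continuousOn ?_) (summable_thU (|t| + 1))
    (fun n _ hy => thK_le hy n)
  unfold thK thF
  fun_prop

noncomputable def thH (t : ℝ) : ℝ := Real.exp t + 2 * ∑' n, thF n t

lemma thF_eq (n : ℕ) (t : ℝ) :
    thF n t = Real.exp t * Real.exp (-Real.pi * Real.exp (4 * t) * ((n : ℝ) + 1) ^ 2) := by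
  unfold thF thA
  rw [← Real.exp_add]
  congr 1
  ring

lemma thH_eq (t : ℝ) :
    thH t = Real.exp t * ∑' n : ℤ, Real.exp (-Real.pi * Real.exp (4 * t) * (n : ℝ) ^ 2) := by
  have hs : Summable fun n : ℕ =>
      Real.exp (-Real.pi * Real.exp (4 * t) * ((n : ℝ) + 1) ^ 2) := by
    have := (summable_thF t).mul_left (Real.exp (-t))
    refine this.congr fun n => ?_
    rw [thF_eq, ← mul_assoc, ← Real.exp_add]
    simp
  have hs' : Summable fun n : ℕ =>
      Real.exp (-Real.pi * Real.exp (4 * t) * (n : ℝ) ^ 2) := by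
    rw [← summable_nat_add_iff 1]
    simpa using hs
  rw [tsum_of_nat_of_neg_add_one]
  · have h0 := hs'.tsum_eq_zero_add
    simp only [Int.cast_natCast]
    rw [h0]
    unfold thH
    simp only [thF_eq, tsum_mul_left]
    push_cast
    have : ∀ n : ℕ, (-1 + -(n : ℝ)) ^ 2 = ((n : ℝ) + 1) ^ 2 := fun n => by ring
    simp [this]
    ring
  · simpa using hs'
  · refine hs.congr fun n => ?_
    push_cast
    congr 1
    ring

lemma thH_even (t : ℝ) : thH (-t) = thH t := by
  rw [thH_eq, thH_eq, Real.tsum_exp_neg_mul_int_sq (Real.exp_pos (4 * t))]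
  have h1 : Real.exp (4 * t) ^ ((1 : ℝ) / 2) = Real.exp (2 * t) := by
    rw [← Real.exp_mul]; congr 1; ring
  have h2 : ∀ n : ℤ, -Real.pi / Real.exp (4 * t) * (n : ℝ) ^ 2
      = -Real.pi * Real.exp (4 * -t) * (n : ℝ) ^ 2 := by
    intro n
    rw [mul_neg, Real.exp_neg]; field_simp
  simp only [h2]
  rw [h1, ← mul_assoc, one_div, ← Real.exp_neg, ← Real.exp_add]
  congr 2
  ring

lemma hasDerivAt_thH (t : ℝ) : HasDerivAt thH (Real.exp t + 2 * ∑' n, thG n t) t :=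
  (Real.hasDerivAt_exp t).add ((hasDerivAt_sF t).const_mul 2)

lemma hasDerivAt_thH' (t : ℝ) : HasDerivAt (fun t => Real.exp t + 2 * ∑' n, thG n t)
    (Real.exp t + 2 * ∑' n, thK n t) t :=
  (Real.hasDerivAt_exp t).add ((hasDerivAt_sG t).const_mul 2)

lemma jacobiPhi_term (n : ℕ) (t : ℝ) : Real.pi * ((n : ℝ) + 1) ^ 2 *
    (2 * Real.pi * ((n : ℝ) + 1) ^ 2 * Real.exp (4 * t) - 3) *
    Real.exp (5 * t - Real.pi * ((n : ℝ) + 1) ^ 2 * Real.exp (4 * t))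
    = (thK n t - thF n t) / 8 := by
  have h : Real.exp (5 * t - Real.pi * ((n : ℝ) + 1) ^ 2 * Real.exp (4 * t))
    = Real.exp (4 * t) * thF n t := by
    unfold thF thA
    rw [← Real.exp_add]; congr 1; ring
  rw [h]
  unfold thK thA
  ring

lemma jacobiPhi_eq (t : ℝ) :
    jacobiPhi t = ((Real.exp t + 2 * ∑' n, thK n t) - thH t) / 16 := by
  unfold jacobiPhi
  simp only [jacobiPhi_term]
  rw [tsum_div_const, (summable_thK t).tsum_sub (summable_thF t)]
  unfold thH
  ring

lemma jacobiPhi_even (t : ℝ) : jacobiPhi (-t) = jacobiPhi t := by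
  have h1 : ∀ t, Real.exp (-t) + 2 * ∑' n, thG n (-t) = -(Real.exp t + 2 * ∑' n, thG n t) := by
    intro t
    have a : HasDerivAt (fun t => thH (-t)) (Real.exp t + 2 * ∑' n, thG n t) t := by
      simp only [thH_even]; exact hasDerivAt_thH t
    have b := (hasDerivAt_thH (-t)).comp t (hasDerivAt_neg t)
    have := a.unique b
    linarith
  have h2 : Real.exp (-t) + 2 * ∑' n, thK n (-t) = Real.exp t + 2 * ∑' n, thK n t := by
    have a := (hasDerivAt_thH' t).neg
    have b := (hasDerivAt_thH' (-t)).comp t (hasDerivAt_neg t)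
    have e : ((fun t => Real.exp t + 2 * ∑' n, thG n t) ∘ Neg.neg)
        = -(fun t => Real.exp t + 2 * ∑' n, thG n t) := by
      ext s
      exact h1 s
    rw [e] at b
    have := a.unique b
    linarith
  rw [jacobiPhi_eq, jacobiPhi_eq, h2, thH_even]

lemma jacobiPhi_continuous : Continuous jacobiPhi := by
  have : jacobiPhi = fun t => ((Real.exp t + 2 * ∑' n, thK n t) - thH t) / 16 :=
    funext jacobiPhi_eq
  rw [this]
  have h1 := continuous_sK
  have h2 : Continuous thH := continuous_iff_continuousAt.2 fun t => (hasDerivAt_thH t).continuousAt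
  fun_prop

lemma jacobiPhi_pos_aux {t : ℝ} (ht : 0 ≤ t) : 0 < jacobiPhi t := by
  have hs : Summable fun n => (thK n t - thF n t) / 8 :=
    ((summable_thK t).sub (summable_thF t)).div_const 8
  have hp : ∀ n, 0 < (thK n t - thF n t) / 8 := by
    intro n
    have hF : 0 < thF n t := Real.exp_pos _
    have h1 : 1 ≤ Real.exp (4 * t) := Real.one_le_exp (by linarith)
    have h3 : 3 < thA n * Real.exp (4 * t) := by
      have := thA_ge n
      nlinarith [Real.pi_gt_three]
    have : thK n t - thF n t
      = 8 * (thA n * Real.exp (4 * t)) * (2 * (thA n * Real.exp (4 * t)) - 3) * thF n t := by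
      unfold thK; ring
    rw [this]
    have : 0 < 2 * (thA n * Real.exp (4 * t)) - 3 := by linarith
    positivity
  unfold jacobiPhi
  simp only [jacobiPhi_term]
  exact hs.tsum_pos (fun n => (hp n).le) 0 (hp 0)

lemma jacobiPhi_pos (t : ℝ) : 0 < jacobiPhi t := by
  rcases le_total 0 t with h | h
  · exact jacobiPhi_pos_aux h
  · rw [← jacobiPhi_even]; exact jacobiPhi_pos_aux (by linarith)

lemma jacobiPhi_decay_aux : ∃ C, 0 < C ∧ ∀ t, 0 ≤ t →
    jacobiPhi t ≤ C * Real.exp (9 * t - Real.exp (4 * t)) := by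
  have hs := (summable_thA 2 (b := 1 / 2) (by norm_num)).mul_left 2
  refine ⟨∑' n, 2 * (thA n ^ 2 * Real.exp (-(thA n * (1 / 2)))), ?_, ?_⟩
  · refine hs.tsum_pos (fun n => by positivity) 0 ?_
    have := thA_pos 0
    positivity
  intro t ht
  rw [← tsum_mul_right]
  have hs2 : Summable fun n => (thK n t - thF n t) / 8 :=
    ((summable_thK t).sub (summable_thF t)).div_const 8
  unfold jacobiPhi
  simp only [jacobiPhi_term]
  refine hs2.tsum_le_tsum (fun n => ?_) (hs.mul_right _)
  have hF : 0 < thF n t := Real.exp_pos _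
  have hA := thA_pos n
  set E := Real.exp (4 * t) with hE
  have h1 : 1 ≤ E := Real.one_le_exp (by linarith)
  have e1 : (thK n t - thF n t) / 8 ≤ 2 * thA n ^ 2 * (E ^ 2 * thF n t) := by
    have : thK n t - thF n t
      = 8 * (thA n * E) * (2 * (thA n * E) - 3) * thF n t := by
      unfold thK; ring
    rw [this]
    have : 0 ≤ (thA n * E) * thF n t := by positivity
    nlinarith
  have e2 : E ^ 2 * thF n t ≤ Real.exp (-(thA n * (1 / 2))) * Real.exp (9 * t - E) := by
    unfold thF
    rw [hE, ← Real.exp_nat_mul, ← Real.exp_add, ← Real.exp_add]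
    apply Real.exp_le_exp.2
    rw [← hE]
    have h3 : 3 ≤ thA n := by linarith [thA_ge n, Real.pi_gt_three]
    push_cast
    nlinarith [mul_nonneg (sub_nonneg.2 h1) (sub_nonneg.2 h3)]
  calc _ ≤ _ := e1
    _ ≤ 2 * thA n ^ 2 * (Real.exp (-(thA n * (1 / 2))) * Real.exp (9 * t - E)) := by gcongr
    _ = _ := by ring

/-- Super-Gaussian decay. -/
lemma jacobiPhi_decay (A : ℝ) : ∃ C, 0 < C ∧ ∀ t, jacobiPhi t ≤ C * Real.exp (-(A * t ^ 2)) := by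
  obtain ⟨C, hC, h⟩ := jacobiPhi_decay_aux
  obtain ⟨D, hD⟩ : ∃ D, ∀ t : ℝ, 0 ≤ t → 9 * t - Real.exp (4 * t) + A * t ^ 2 ≤ D := by
    refine ⟨9 * (|A| + 9) + |A| * (|A| + 9) ^ 2, fun t ht => ?_⟩
    have hA : A * t ^ 2 ≤ |A| * t ^ 2 := by gcongr; exact le_abs_self A
    have hA0 := abs_nonneg A
    rcases le_total t (|A| + 9) with h1 | h1
    · have : |A| * t ^ 2 ≤ |A| * (|A| + 9) ^ 2 := by gcongr
      linarith [Real.exp_pos (4 * t)]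
    · have h2 : (4 * t) ^ 3 / 6 ≤ Real.exp (4 * t) := by
        have := Real.pow_div_factorial_le_exp (4 * t) (by linarith) 3
        simpa [Nat.factorial] using this
      have h3 : |A| * t ^ 2 + 9 * t ≤ t ^ 3 := by
        have : t * t ^ 2 ≥ (|A| + 9) * t ^ 2 := by gcongr
        nlinarith
      have : 0 ≤ 9 * (|A| + 9) + |A| * (|A| + 9) ^ 2 := by positivity
      nlinarith [pow_nonneg ht 3]
  have key : ∀ t, 0 ≤ t → jacobiPhi t ≤ C * Real.exp D * Real.exp (-(A * t ^ 2)) := by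
    intro t ht
    refine (h t ht).trans ?_
    rw [mul_assoc, ← Real.exp_add]
    gcongr
    linarith [hD t ht]
  refine ⟨C * Real.exp D, by positivity, fun t => ?_⟩
  rcases le_total 0 t with ht | ht
  · exact key t ht
  · have := key (-t) (by linarith)
    rwa [jacobiPhi_even, neg_sq] at this

end PartA

section PartB

open MeasureTheory

/-! ### Part 2: the entire function `F` -/

lemma phi_bound (k : ℕ) (r : ℝ) : ∃ C, ∀ t : ℝ,
    |t| ^ k * Real.exp (r * |t|) * jacobiPhi t ≤ C * Real.exp (-(1 * t ^ 2)) := by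
  obtain ⟨C, hC, h⟩ := jacobiPhi_decay 2
  refine ⟨(Nat.factorial k) * C * Real.exp ((r + 1) ^ 2), fun t => ?_⟩
  have h1 : |t| ^ k ≤ Nat.factorial k * Real.exp |t| := by
    have := Real.pow_div_factorial_le_exp |t| (abs_nonneg t) k
    rwa [div_le_iff₀ (by positivity), mul_comm] at this
  calc |t| ^ k * Real.exp (r * |t|) * jacobiPhi t
      ≤ (Nat.factorial k * Real.exp |t|) * Real.exp (r * |t|) *
          (C * Real.exp (-(2 * t ^ 2))) := by
        have := jacobiPhi_pos t
        gcongr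
        exact h t
    _ = Nat.factorial k * C * Real.exp (|t| + r * |t| + -(2 * t ^ 2)) := by
        rw [Real.exp_add, Real.exp_add]; ring
    _ ≤ Nat.factorial k * C * Real.exp ((r + 1) ^ 2 + -(1 * t ^ 2)) := by
        refine mul_le_mul_of_nonneg_left (Real.exp_le_exp.2 ?_) (by positivity)
        have := sq_nonneg (r + 1 - |t|)
        have h2 : |t| ^ 2 = t ^ 2 := sq_abs t
        nlinarith [sq_nonneg (r + 1), sq_nonneg t, sq_nonneg (r + 1 - |t|)]
    _ = _ := by rw [Real.exp_add]; ring

lemma phi_integrable (k : ℕ) (r : ℝ) :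
    Integrable fun t : ℝ => |t| ^ k * Real.exp (r * |t|) * jacobiPhi t := by
  obtain ⟨C, h⟩ := phi_bound k r
  refine Integrable.mono' ((integrable_exp_neg_mul_sq (b := 1) one_pos).const_mul C) ?_ ?_
  · have := jacobiPhi_continuous
    exact Continuous.aestronglyMeasurable (by fun_prop)
  · refine Filter.Eventually.of_forall fun t => ?_
    have := jacobiPhi_pos t
    rw [Real.norm_of_nonneg (by positivity)]
    simpa using h t

noncomputable def phiM (k : ℕ) (z : ℂ) (t : ℝ) : ℂ :=
  (Complex.I * t) ^ k * ((jacobiPhi t : ℂ) * Complex.exp (Complex.I * z * t))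

lemma phiM_continuous (k : ℕ) (z : ℂ) : Continuous (phiM k z) := by
  have := jacobiPhi_continuous
  unfold phiM
  fun_prop

lemma norm_phiM_le (k : ℕ) {z : ℂ} {r : ℝ} (hz : ‖z‖ ≤ r) (t : ℝ) :
    ‖phiM k z t‖ ≤ |t| ^ k * Real.exp (r * |t|) * jacobiPhi t := by
  unfold phiM
  have h0 := jacobiPhi_pos t
  rw [norm_mul, norm_pow, norm_mul, Complex.norm_I, one_mul, norm_mul, Complex.norm_real,
    Complex.norm_real, Real.norm_of_nonneg h0.le, Complex.norm_exp, mul_assoc (|t| ^ k),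
    mul_comm (Real.exp (r * |t|)), Real.norm_eq_abs]
  gcongr
  have h1 : (Complex.I * z * t).re ≤ ‖Complex.I * z * t‖ := Complex.re_le_norm _
  rw [norm_mul, norm_mul, Complex.norm_I, one_mul, Complex.norm_real, Real.norm_eq_abs] at h1
  refine h1.trans ?_
  gcongr

lemma phiM_integrable (k : ℕ) (z : ℂ) : Integrable (phiM k z) := by
  refine Integrable.mono' (phi_integrable k ‖z‖) (phiM_continuous k z).aestronglyMeasurable ?_
  exact Filter.Eventually.of_forall fun t => norm_phiM_le k le_rfl t

lemma hasDerivAt_phiM (k : ℕ) (z : ℂ) :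
    HasDerivAt (fun z => ∫ t, phiM k z t) (∫ t, phiM (k + 1) z t) z := by
  refine (hasDerivAt_integral_of_dominated_loc_of_deriv_le (s := Metric.ball z 1)
    (F' := fun z t => phiM (k + 1) z t)
    (bound := fun t => |t| ^ (k + 1) * Real.exp ((‖z‖ + 1) * |t|) * jacobiPhi t)
    (Metric.ball_mem_nhds z one_pos) ?_ (phiM_integrable k z)
    (phiM_continuous _ z).aestronglyMeasurable ?_ (phi_integrable _ _) ?_).2
  · exact Filter.Eventually.of_forall fun w => (phiM_continuous k w).aestronglyMeasurable
  · refine Filter.Eventually.of_forall fun t w hw => norm_phiM_le _ ?_ t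
    have : ‖w - z‖ < 1 := by simpa [dist_eq_norm] using hw
    have := norm_le_norm_add_norm_sub' w z
    linarith
  · refine Filter.Eventually.of_forall fun t w _ => ?_
    have h1 : HasDerivAt (fun w : ℂ => Complex.I * w * t) (Complex.I * 1 * t) w :=
      ((hasDerivAt_id w).const_mul Complex.I).mul_const _
    refine ((h1.cexp.const_mul (jacobiPhi t : ℂ)).const_mul ((Complex.I * t) ^ k)).congr_deriv ?_
    unfold phiM
    ring

lemma fourierPhi_eq : fourierPhi = fun z => ∫ t, phiM 0 z t := by
  ext z
  simp [fourierPhi, phiM]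

lemma iteratedDeriv_fourierPhi (k : ℕ) : iteratedDeriv k fourierPhi = fun z => ∫ t, phiM k z t := by
  induction k with
  | zero => rw [iteratedDeriv_zero, fourierPhi_eq]
  | succ k ih =>
    rw [iteratedDeriv_succ, ih]
    ext z
    exact (hasDerivAt_phiM k z).deriv

lemma fourierPhi_differentiable : Differentiable ℂ fourierPhi := by
  rw [fourierPhi_eq]
  exact fun z => (hasDerivAt_phiM 0 z).differentiableAt

lemma iteratedDeriv_fourierPhi_continuous (k : ℕ) : Continuous (iteratedDeriv k fourierPhi) := by
  rw [iteratedDeriv_fourierPhi]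
  exact continuous_iff_continuousAt.2 fun z => (hasDerivAt_phiM k z).continuousAt

lemma fourierPhi_zero_ne : fourierPhi 0 ≠ 0 := by
  have h : fourierPhi 0 = ((∫ t, jacobiPhi t : ℝ) : ℂ) := by
    rw [← integral_complex_ofReal]
    simp [fourierPhi]
  rw [h]
  have hi : Integrable jacobiPhi := by simpa using phi_integrable 0 0
  have : 0 < ∫ t, jacobiPhi t := by
    refine (integral_pos_iff_support_of_nonneg (fun t => (jacobiPhi_pos t).le) hi).2 ?_
    have : Function.support jacobiPhi = Set.univ := by
      ext t; simp [(jacobiPhi_pos t).ne']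
    rw [this]; simp
  exact_mod_cast this.ne'

lemma fourierPhi_neg (z : ℂ) : fourierPhi (-z) = fourierPhi z := by
  unfold fourierPhi
  rw [← integral_neg_eq_self]
  congr 1
  ext t
  rw [jacobiPhi_even]
  congr 2
  push_cast
  ring

lemma fourierPhi_conj (z : ℂ) :
    fourierPhi ((starRingEnd ℂ) z) = (starRingEnd ℂ) (fourierPhi z) := by
  rw [← fourierPhi_neg]
  unfold fourierPhi
  rw [← integral_conj]
  congr 1
  ext t
  simp [← Complex.exp_conj]

lemma fourierPhi_growth {ε : ℝ} (hε : 0 < ε) :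
    ∃ C, 0 < C ∧ ∀ z, ‖fourierPhi z‖ ≤ C * Real.exp (ε * ‖z‖ ^ 2) := by
  obtain ⟨C, hC, h⟩ := jacobiPhi_decay (1 / (4 * ε) + 1)
  refine ⟨C * (∫ t : ℝ, Real.exp (-1 * t ^ 2)), ?_, fun z => ?_⟩
  · rw [integral_gaussian]; positivity
  rw [fourierPhi_eq, mul_right_comm, ← integral_const_mul]
  refine norm_integral_le_of_norm_le ((integrable_exp_neg_mul_sq one_pos).const_mul _) ?_
  refine Filter.Eventually.of_forall fun t => (norm_phiM_le 0 le_rfl t).trans ?_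
  rw [pow_zero, one_mul, mul_comm C, mul_assoc]
  calc _ ≤ Real.exp (‖z‖ * |t|) * (C * Real.exp (-((1 / (4 * ε) + 1) * t ^ 2))) := by
        gcongr; exact h t
    _ = C * Real.exp (‖z‖ * |t| + -((1 / (4 * ε) + 1) * t ^ 2)) := by rw [Real.exp_add]; ring
    _ ≤ C * Real.exp (ε * ‖z‖ ^ 2 + -1 * t ^ 2) := by
      refine mul_le_mul_of_nonneg_left (Real.exp_le_exp.2 ?_) (by positivity)
      have h2 : |t| ^ 2 = t ^ 2 := sq_abs t
      have : 0 ≤ ε * (‖z‖ - |t| / (2 * ε)) ^ 2 := by positivity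
      have e : ε * (‖z‖ - |t| / (2 * ε)) ^ 2
        = ε * ‖z‖ ^ 2 - ‖z‖ * |t| + 1 / (4 * ε) * |t| ^ 2 := by field_simp; ring
      rw [e, h2] at this
      linarith
    _ = _ := by rw [Real.exp_add]; ring

lemma fourierPhi_eq_xiH (z : ℂ) : fourierPhi z = 2 * xiH z := by
  have hi : Integrable fun t : ℝ => (jacobiPhi t : ℂ) * Complex.exp (Complex.I * z * t) := by
    refine (phiM_integrable 0 z).congr (Filter.Eventually.of_forall fun t => ?_)
    simp [phiM]
  have hi' : Integrable fun t : ℝ => (jacobiPhi t : ℂ) * Complex.exp (Complex.I * (-z) * t) := by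
    refine (phiM_integrable 0 (-z)).congr (Filter.Eventually.of_forall fun t => ?_)
    simp [phiM]
  unfold fourierPhi xiH
  rw [← intervalIntegral.integral_Iic_add_Ioi (b := 0) hi.integrableOn hi.integrableOn]
  have h1 : ∫ t in Set.Iic (0 : ℝ), (jacobiPhi t : ℂ) * Complex.exp (Complex.I * z * t)
      = ∫ t in Set.Ioi (0 : ℝ), (jacobiPhi t : ℂ) * Complex.exp (Complex.I * (-z) * t) := by
    have := integral_comp_neg_Iic (0 : ℝ)
      (fun t : ℝ => (jacobiPhi t : ℂ) * Complex.exp (Complex.I * (-z) * t))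
    rw [neg_zero] at this
    rw [← this]
    congr 1
    ext t
    rw [jacobiPhi_even]
    congr 2
    push_cast
    ring
  rw [h1, ← integral_add hi'.integrableOn hi.integrableOn, ← integral_const_mul]
  congr 1
  ext t
  rw [Complex.cos]
  rw [show z * t * Complex.I = Complex.I * z * t by ring,
    show -(z * t) * Complex.I = Complex.I * (-z) * t by ring]
  ring

end PartB

section PartC

open MeasureTheory

/-! ### Part 3: the kernels `Kₙ` and the Laguerre identity -/

noncomputable def kG (n : ℕ) (t s : ℝ) : ℝ := jacobiPhi (s + t) * jacobiPhi (s - t) * s ^ (2 * n)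

lemma kG_bound (n : ℕ) : ∃ D, 0 < D ∧ ∀ t s, ‖kG n t s‖ ≤ D * Real.exp (-(t ^ 2 + s ^ 2)) := by
  obtain ⟨C, hC, h⟩ := jacobiPhi_decay 1
  refine ⟨C ^ 2 * n.factorial, by positivity, fun t s => ?_⟩
  have p1 := jacobiPhi_pos (s + t)
  have p2 := jacobiPhi_pos (s - t)
  have hs : 0 ≤ s ^ (2 * n) := by rw [pow_mul]; positivity
  have h1 : s ^ (2 * n) ≤ n.factorial * Real.exp (s ^ 2) := by
    have := Real.pow_div_factorial_le_exp (s ^ 2) (sq_nonneg s) n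
    rw [div_le_iff₀ (by positivity), mul_comm] at this
    rwa [pow_mul]
  unfold kG
  rw [Real.norm_of_nonneg (by positivity)]
  calc _ ≤ (C * Real.exp (-(1 * (s + t) ^ 2))) * (C * Real.exp (-(1 * (s - t) ^ 2)))
        * (n.factorial * Real.exp (s ^ 2)) := by
        gcongr
        · exact h _
        · exact h _
    _ = C ^ 2 * n.factorial * Real.exp (-(1 * (s + t) ^ 2) + -(1 * (s - t) ^ 2) + s ^ 2) := by
        rw [Real.exp_add, Real.exp_add]; ring
    _ ≤ _ := by
        refine mul_le_mul_of_nonneg_left (Real.exp_le_exp.2 ?_) (by positivity)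
        nlinarith [sq_nonneg t, sq_nonneg s]

lemma kG_continuous (n : ℕ) : Continuous fun p : ℝ × ℝ => kG n p.1 p.2 := by
  have := jacobiPhi_continuous
  unfold kG
  fun_prop

lemma gauss2_integrable {a b : ℝ} (ha : 0 < a) (hb : 0 < b) (D : ℝ) :
    Integrable (fun p : ℝ × ℝ => D * (Real.exp (-a * p.1 ^ 2) * Real.exp (-b * p.2 ^ 2)))
      (volume.prod volume) :=
  ((integrable_exp_neg_mul_sq ha).mul_prod (integrable_exp_neg_mul_sq hb)).const_mul D

lemma kG_integrable (n : ℕ) :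
    Integrable (fun p : ℝ × ℝ => kG n p.1 p.2) (volume.prod volume) := by
  obtain ⟨D, hD, h⟩ := kG_bound n
  refine Integrable.mono' (gauss2_integrable one_pos one_pos D)
    (kG_continuous n).aestronglyMeasurable (Filter.Eventually.of_forall fun p => ?_)
  refine (h p.1 p.2).trans (le_of_eq ?_)
  rw [← Real.exp_add]; congr 2; ring

lemma assocKernelPhi_eq (n : ℕ) : assocKernelPhi n = fun t => ∫ s, kG n t s := rfl

lemma K_integrable (n : ℕ) : Integrable (assocKernelPhi n) :=
  (kG_integrable n).integral_prod_left

lemma K_continuous (n : ℕ) : Continuous (assocKernelPhi n) := by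
  obtain ⟨D, hD, h⟩ := kG_bound n
  rw [assocKernelPhi_eq]
  refine continuous_of_dominated (bound := fun s => D * Real.exp (-1 * s ^ 2)) ?_ ?_ ?_ ?_
  · intro t
    exact ((kG_continuous n).comp (Continuous.prodMk_right t)).aestronglyMeasurable
  · intro t
    refine Filter.Eventually.of_forall fun s => (h t s).trans ?_
    refine mul_le_mul_of_nonneg_left (Real.exp_le_exp.2 ?_) (by positivity)
    nlinarith [sq_nonneg t]
  · exact (integrable_exp_neg_mul_sq one_pos).const_mul D
  · refine Filter.Eventually.of_forall fun s => ?_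
    exact (kG_continuous n).comp (Continuous.prodMk_left s)

lemma K_even (n : ℕ) (t : ℝ) : assocKernelPhi n (-t) = assocKernelPhi n t := by
  unfold assocKernelPhi
  congr 1
  ext s
  rw [sub_neg_eq_add, ← sub_eq_add_neg]
  ring

noncomputable def kW (n : ℕ) (x : ℝ) (u v : ℝ) : ℂ :=
  ((v : ℂ) - u) ^ (2 * n) * (jacobiPhi u * jacobiPhi v) * Complex.exp (Complex.I * x * (u + v))

lemma kW_continuous (n : ℕ) (x : ℝ) : Continuous fun p : ℝ × ℝ => kW n x p.1 p.2 := by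
  have := jacobiPhi_continuous
  unfold kW
  fun_prop

lemma kW_eq (n : ℕ) (x t s : ℝ) :
    kW n x (t - s) (t + s) = 2 ^ (2 * n) * (kG n t s * Complex.exp (Complex.I * (2 * x * t))) := by
  unfold kW kG
  rw [← jacobiPhi_even (t - s), neg_sub, add_comm t s]
  push_cast
  rw [show (s : ℂ) + t - (t - s) = 2 * s by ring, show (t : ℂ) - s + (s + t) = 2 * t by ring,
    mul_pow, show Complex.I * x * (2 * t) = Complex.I * (2 * x * t) by ring]
  ring

lemma norm_kW (n : ℕ) (x t s : ℝ) : ‖kW n x (t - s) (t + s)‖ = 2 ^ (2 * n) * ‖kG n t s‖ := by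
  rw [kW_eq, norm_mul, norm_mul, Complex.norm_real, Complex.norm_exp]
  simp

lemma Lag_eq_aux (n : ℕ) (x : ℝ) : Lag fourierPhi n x =
    1 / (Nat.factorial (2 * n)) * ∫ p : ℝ × ℝ, kW n x p.1 p.2 ∂(volume.prod volume) := by
  unfold Lag
  have hIntg : ∀ j k, Integrable (fun p : ℝ × ℝ => phiM j x p.1 * phiM k x p.2)
    (volume.prod volume) := fun j k => (phiM_integrable j x).mul_prod (phiM_integrable k x)
  have h1 : ∀ j ∈ Finset.range (2 * n + 1),
    (-1 : ℂ) ^ (j + n) / (Nat.factorial (2 * n)) * (Nat.choose (2 * n) j) *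
      iteratedDeriv j fourierPhi x * iteratedDeriv (2 * n - j) fourierPhi x
    = ∫ p : ℝ × ℝ, (-1 : ℂ) ^ (j + n) / (Nat.factorial (2 * n)) * (Nat.choose (2 * n) j) *
      (phiM j x p.1 * phiM (2 * n - j) x p.2) ∂(volume.prod volume) := by
    intro j _
    rw [integral_const_mul, integral_prod_mul, iteratedDeriv_fourierPhi, iteratedDeriv_fourierPhi]
    ring
  rw [Finset.sum_congr rfl h1, ← integral_finsetSum _ (fun j _ => (hIntg _ _).const_mul _),
    ← integral_const_mul]
  congr 1
  ext ⟨u, v⟩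
  unfold kW
  simp only
  rw [show (v : ℂ) - u = -u + v by ring, add_pow, Finset.sum_mul, Finset.sum_mul, Finset.mul_sum]
  refine Finset.sum_congr rfl fun j hj => ?_
  have hj' : j + (2 * n - j) = 2 * n := by have := Finset.mem_range.1 hj; omega
  unfold phiM
  have hI : Complex.I ^ j * Complex.I ^ (2 * n - j) = (-1) ^ n := by
    rw [← pow_add, hj', pow_mul, Complex.I_sq]
  have hs : (-1 : ℂ) ^ (j + n) * (-1) ^ n = (-1) ^ j := by
    rw [pow_add, mul_assoc, ← mul_pow]; simp
  rw [mul_add (Complex.I * x), Complex.exp_add, mul_pow, mul_pow, neg_pow (u : ℂ)]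
  rw [← hs, ← hI]
  ring

lemma kW_integral (n : ℕ) (x : ℝ) : ∫ p : ℝ × ℝ, kW n x p.1 p.2 ∂(volume.prod volume)
    = 2 * ∫ t, ∫ s, kW n x (t - s) (t + s) := by
  have hIntg : Integrable (fun p : ℝ × ℝ => kW n x p.1 p.2) (volume.prod volume) := by
    obtain ⟨D, hD, h⟩ := kG_bound n
    refine Integrable.mono' (gauss2_integrable (a := 1 / 2) (b := 1 / 2) (by norm_num)
      (by norm_num) (2 ^ (2 * n) * D))
      (kW_continuous n x).aestronglyMeasurable (Filter.Eventually.of_forall fun p => ?_)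
    have e1 : p.1 = (p.1 + p.2) / 2 - (p.2 - p.1) / 2 := by ring
    have e2 : p.2 = (p.1 + p.2) / 2 + (p.2 - p.1) / 2 := by ring
    rw [show kW n x p.1 p.2 = kW n x ((p.1 + p.2) / 2 - (p.2 - p.1) / 2)
      ((p.1 + p.2) / 2 + (p.2 - p.1) / 2) by rw [← e1, ← e2], norm_kW, mul_assoc, ← Real.exp_add]
    refine mul_le_mul_of_nonneg_left ((h _ _).trans (le_of_eq ?_)) (by positivity)
    congr 2
    ring
  have hIntg2 : Integrable (fun p : ℝ × ℝ => kW n x p.1 (p.1 + 2 * p.2)) (volume.prod volume) := by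
    obtain ⟨D, hD, h⟩ := kG_bound n
    refine Integrable.mono' (gauss2_integrable (a := 1 / 4) (b := 1 / 2) (by norm_num)
      (by norm_num) (2 ^ (2 * n) * D)) ?_ (Filter.Eventually.of_forall fun p => ?_)
    · have : Continuous fun p : ℝ × ℝ => (p.1, p.1 + 2 * p.2) := by fun_prop
      exact ((kW_continuous n x).comp this).aestronglyMeasurable
    rw [show kW n x p.1 (p.1 + 2 * p.2) = kW n x ((p.1 + p.2) - p.2)
      ((p.1 + p.2) + p.2) by congr 1 <;> ring, norm_kW, mul_assoc, ← Real.exp_add]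
    refine mul_le_mul_of_nonneg_left ((h _ _).trans ?_) (by positivity)
    refine mul_le_mul_of_nonneg_left (Real.exp_le_exp.2 ?_) hD.le
    nlinarith [sq_nonneg (p.1 + 2 * p.2), sq_nonneg (3 * p.1 + 4 * p.2), sq_nonneg p.1]
  have hIntg3 : Integrable (fun p : ℝ × ℝ => kW n x (p.1 - p.2) (p.1 + p.2))
      (volume.prod volume) := by
    refine Integrable.mono' ((kG_integrable n).norm.const_mul (2 ^ (2 * n))) ?_
      (Filter.Eventually.of_forall fun p => (norm_kW n x _ _).le)
    have : Continuous fun p : ℝ × ℝ => (p.1 - p.2, p.1 + p.2) := by fun_prop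
    exact ((kW_continuous n x).comp this).aestronglyMeasurable
  rw [integral_prod _ hIntg]
  have h1 : ∀ u, ∫ v, kW n x u v = 2 * ∫ s, kW n x u (u + 2 * s) := by
    intro u
    rw [Measure.integral_comp_mul_left (fun v => kW n x u (u + v)) 2,
      integral_add_left_eq_self (fun v => kW n x u v)]
    simp
  simp only [h1]
  rw [integral_const_mul, integral_integral_swap hIntg2]
  congr 1
  have h2 : ∀ s, ∫ u, kW n x u (u + 2 * s) = ∫ t, kW n x (t - s) (t + s) := by
    intro s
    rw [← integral_sub_right_eq_self (fun u => kW n x u (u + 2 * s)) s]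
    congr 1
    ext t
    congr 1
    ring
  simp only [h2]
  exact (integral_integral_swap hIntg3).symm

lemma K_fourier (n : ℕ) (x : ℝ) :
    ∫ t, (assocKernelPhi n t : ℂ) * Complex.exp (Complex.I * (2 * x * t))
    = ((∫ t : ℝ, assocKernelPhi n t * Real.cos (2 * x * t) : ℝ) : ℂ) := by
  have hi : ∀ x : ℝ, Integrable fun t : ℝ =>
      (assocKernelPhi n t : ℂ) * Complex.exp (Complex.I * (2 * x * t)) := by
    intro x
    refine Integrable.mono' (K_integrable n).norm ?_ (Filter.Eventually.of_forall fun t => ?_)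
    · have := K_continuous n
      exact Continuous.aestronglyMeasurable (by fun_prop)
    · rw [norm_mul, Complex.norm_exp]; simp
  have h1 : ∫ t, (assocKernelPhi n t : ℂ) * Complex.exp (Complex.I * (2 * x * t))
    = ∫ t, (assocKernelPhi n t : ℂ) * Complex.exp (Complex.I * (2 * (-x : ℝ) * t)) := by
    rw [← integral_neg_eq_self]
    congr 1
    ext t
    rw [K_even]
    congr 2
    push_cast
    ring
  rw [← integral_complex_ofReal]
  have h2 : ∀ a b : ℂ, a = b → a = (1 / 2) * (a + b) := by
    intro a b h; rw [h]; ring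
  rw [h2 _ _ h1, ← integral_add (hi _) (hi _), ← integral_const_mul]
  congr 1
  ext t
  push_cast
  rw [Complex.cos, show (2 : ℂ) * x * t * Complex.I = Complex.I * (2 * x * t) by ring,
    show -((2 : ℂ) * x * t) * Complex.I = Complex.I * (2 * -x * t) by ring]
  ring

lemma Lag_eq (n : ℕ) (x : ℝ) :
    Lag fourierPhi n (x : ℂ) =
        ((2 * 2 ^ (2 * n) / (Nat.factorial (2 * n)) *
          ∫ t : ℝ, assocKernelPhi n t * Real.cos (2 * x * t) : ℝ) : ℂ) := by
  rw [Lag_eq_aux, kW_integral]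
  simp only [kW_eq]
  rw [Complex.ofReal_mul, ← K_fourier]
  have : ∀ t : ℝ, ∫ s, 2 ^ (2 * n) * ((kG n t s : ℂ) * Complex.exp (Complex.I * (2 * x * t)))
      = 2 ^ (2 * n) * ((assocKernelPhi n t : ℂ) * Complex.exp (Complex.I * (2 * x * t))) := by
    intro t
    rw [integral_const_mul, integral_mul_const, assocKernelPhi_eq, integral_complex_ofReal]
  simp only [this]
  rw [integral_const_mul]
  push_cast
  ring

end PartC

section PartD

open ComplexOrder

/-! ### Part 4: entire functions of small growth with negative zeros -/

/-- Entire functions with nonnegative Taylor coefficients. -/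
def NNCoef (f : ℂ → ℂ) : Prop := Differentiable ℂ f ∧ ∀ n, 0 ≤ iteratedDeriv n f 0

lemma NNCoef.mul {f g : ℂ → ℂ} (hf : NNCoef f) (hg : NNCoef g) :
    NNCoef (fun w => f w * g w) := by
  refine ⟨hf.1.mul hg.1, fun n => ?_⟩
  rw [iteratedDeriv_fun_mul hf.1.contDiff.contDiffAt hg.1.contDiff.contDiffAt]
  refine Finset.sum_nonneg fun i _ => ?_
  exact mul_nonneg (mul_nonneg (by exact_mod_cast Nat.zero_le _) (hf.2 i)) (hg.2 _)

lemma NNCoef.const {c : ℂ} (hc : 0 ≤ c) : NNCoef (fun _ => c) := by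
  refine ⟨by fun_prop, fun n => ?_⟩
  rw [iteratedDeriv_const]
  split_ifs
  · exact hc
  · exact le_rfl

lemma NNCoef.linear {a : ℂ} (ha : 0 ≤ a) : NNCoef (fun w => 1 + a * w) := by
  refine ⟨by fun_prop, fun n => ?_⟩
  cases n with
  | zero => simp
  | succ n =>
    rw [iteratedDeriv_succ']
    have : deriv (fun w : ℂ => 1 + a * w) = fun _ => a := by
      ext w
      have : HasDerivAt (fun w : ℂ => 1 + a * w) (a * 1) w :=
        ((hasDerivAt_id w).const_mul a).const_add 1
      simpa using this.deriv
    rw [this]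
    exact (NNCoef.const ha).2 n

lemma NNCoef.prod (l : List ℂ) (hl : ∀ c ∈ l, c.im = 0 ∧ c.re < 0) :
    NNCoef (fun w => (l.map (fun c => 1 - w / c)).prod) := by
  induction l with
  | nil => simpa using NNCoef.const (c := 1) zero_le_one
  | cons c l ih =>
    simp only [List.map_cons, List.prod_cons]
    refine NNCoef.mul ?_ (ih fun d hd => hl d (List.mem_cons_of_mem _ hd))
    obtain ⟨h1, h2⟩ := hl c (List.mem_cons_self)
    have hc : c = ((c.re : ℝ) : ℂ) := by
      apply Complex.ext <;> simp [h1]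
    have : (0 : ℂ) ≤ ((-(1 / c.re) : ℝ) : ℂ) := by
      rw [Complex.zero_le_real]
      have : 1 / c.re < 0 := one_div_neg.2 h2
      linarith
    convert! NNCoef.linear this using 2 with w
    rw [hc]
    push_cast
    simp only [Complex.ofReal_re]
    ring

def Fac (Q : ℂ → ℂ) (R : ℝ) (l : List ℂ) (G : ℂ → ℂ) : Prop :=
  Differentiable ℂ G ∧ (∀ c ∈ l, c ≠ 0 ∧ ‖c‖ ≤ R) ∧
    ∀ w, Q w = (l.map (fun c => 1 - w / c)).prod * G w

lemma Fac.zero {Q : ℂ → ℂ} {R : ℝ} {l : List ℂ} {G : ℂ → ℂ} (h : Fac Q R l G) : G 0 = Q 0 := by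
  rw [h.2.2 0]
  simp

lemma prod_lower {R : ℝ} {l : List ℂ} (hl : ∀ c ∈ l, c ≠ 0 ∧ ‖c‖ ≤ R) {w : ℂ}
    (hw : ‖w‖ = 3 * R) : 2 ^ l.length ≤ ‖(l.map (fun c => 1 - w / c)).prod‖ := by
  induction l with
  | nil => simp
  | cons c l ih =>
    simp only [List.map_cons, List.prod_cons, List.length_cons, norm_mul, pow_succ]
    rw [mul_comm]
    have h1 := ih fun d hd => hl d (List.mem_cons_of_mem _ hd)
    obtain ⟨h2, h3⟩ := hl c (List.mem_cons_self)
    have h4 : 0 < ‖c‖ := norm_pos_iff.2 h2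
    have h5 : 3 ≤ ‖w / c‖ := by
      rw [norm_div, hw, le_div_iff₀ h4]; linarith
    have h6 : 2 ≤ ‖1 - w / c‖ := by
      have := norm_sub_norm_le (w / c) 1
      rw [norm_sub_rev] at this
      simp at this
      rw [norm_div] at h5
      linarith
    gcongr

lemma Fac.bound {Q : ℂ → ℂ} {R M : ℝ} (hR : 0 < R) {l : List ℂ} {G : ℂ → ℂ}
    (hM : ∀ w, ‖w‖ = 3 * R → ‖Q w‖ ≤ M) (h : Fac Q R l G) {w : ℂ} (hw : ‖w‖ ≤ 3 * R) :
    ‖G w‖ * 2 ^ l.length ≤ M := by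
  rw [← le_div_iff₀ (by positivity)]
  have h3 : 3 * R ≠ 0 := by positivity
  refine Complex.norm_le_of_forall_mem_frontier_norm_le (U := Metric.ball 0 (3 * R))
    Metric.isBounded_ball h.1.diffContOnCl ?_ ?_
  · intro z hz
    rw [frontier_ball _ h3] at hz
    have hz' : ‖z‖ = 3 * R := by simpa using hz
    rw [le_div_iff₀ (by positivity)]
    have := hM z hz'
    rw [h.2.2, norm_mul, mul_comm] at this
    refine le_trans ?_ this
    gcongr
    exact prod_lower h.2.1 hz'
  · rw [closure_ball _ h3]
    simpa using hw

lemma exists_fac {Q : ℂ → ℂ} {R M : ℝ} (hR : 0 < R) (hQ : Differentiable ℂ Q) (h0 : Q 0 ≠ 0)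
    (hM : ∀ w, ‖w‖ = 3 * R → ‖Q w‖ ≤ M) :
    ∃ l G, Fac Q R l G ∧ ∀ w, ‖w‖ ≤ R → G w ≠ 0 := by
  by_contra hcon
  push Not at hcon
  have key : ∀ N : ℕ, ∃ l G, Fac Q R l G ∧ l.length = N := by
    intro N
    induction N with
    | zero => exact ⟨[], Q, ⟨hQ, by simp, by simp⟩, rfl⟩
    | succ N ih =>
      obtain ⟨l, G, hF, hl⟩ := ih
      obtain ⟨c, hc, hGc⟩ := hcon l G hF
      have hc0 : c ≠ 0 := by
        rintro rfl
        exact h0 (hF.zero ▸ hGc)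
      refine ⟨c :: l, fun w => -c * dslope G c w, ⟨?_, ?_, ?_⟩, by simp [hl]⟩
      · have : Differentiable ℂ (dslope G c) := by
          rw [← differentiableOn_univ, Complex.differentiableOn_dslope Filter.univ_mem]
          exact hF.1.differentiableOn
        exact this.const_mul _
      · intro d hd
        rcases List.mem_cons.1 hd with rfl | hd
        · exact ⟨hc0, hc⟩
        · exact hF.2.1 d hd
      · intro w
        rw [hF.2.2 w]
        have : G w = (w - c) * dslope G c w := by
          have := sub_smul_dslope G c w
          rw [hGc, sub_zero] at this
          simpa using this.symm
        rw [this]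
        simp only [List.map_cons, List.prod_cons]
        field_simp
        ring
  obtain ⟨N, hN⟩ := pow_unbounded_of_one_lt (M / ‖Q 0‖) (one_lt_two (α := ℝ))
  obtain ⟨l, G, hF, hl⟩ := key N
  have := hF.bound hR hM (w := 0) (by simp; positivity)
  rw [hF.zero, hl] at this
  rw [div_lt_iff₀ (norm_pos_iff.2 h0)] at hN
  linarith

lemma approx_one {Q : ℂ → ℂ} {R m : ℝ} (hR : 0 < R) (hm : 0 < m) (hQ : Differentiable ℂ Q)
    (h0 : Q 0 ≠ 0) (hM : ∀ w, ‖w‖ = 3 * R → ‖Q w‖ ≤ ‖Q 0‖ * Real.exp m)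
    (hz : ∀ w, Q w = 0 → w.im = 0 ∧ w.re < 0) :
    ∃ P g : ℂ → ℂ, NNCoef P ∧ ∀ w, ‖w‖ < R →
      Q w = P w * Q 0 * Complex.exp (g w) ∧ ‖g w‖ ≤ 2 * m * ‖w‖ / (R - ‖w‖) := by
  obtain ⟨l, G, hF, hG⟩ := exists_fac hR hQ h0 hM
  have hP : NNCoef (fun w => (l.map (fun c => 1 - w / c)).prod) := by
    refine NNCoef.prod l fun c hc => hz c ?_
    rw [hF.2.2 c]
    have : (l.map (fun d => 1 - c / d)).prod = 0 := by
      rw [List.prod_eq_zero_iff, List.mem_map]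
      exact ⟨c, hc, by rw [div_self (hF.2.1 c hc).1, sub_self]⟩
    rw [this, zero_mul]
  have hG' : ∀ w ∈ Metric.ball (0 : ℂ) R, G w ≠ 0 := fun w hw => hG w (by
    have : ‖w‖ < R := by simpa using hw
    exact this.le)
  have hdG : Differentiable ℂ (deriv G) := by
    have := hF.1.contDiff (n := 2)
    exact (this.differentiable_deriv_two)
  have hex : Complex.IsExactOn (fun w => deriv G w / G w) (Metric.ball 0 R) :=
    DifferentiableOn.isExactOn_ball (hdG.differentiableOn.div hF.1.differentiableOn hG')
  obtain ⟨g, hg0, hg⟩ := hex.with_val_at 0 0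
  have hdiff : ∀ w ∈ Metric.ball (0 : ℂ) R,
      HasDerivAt (fun w => G w * Complex.exp (-g w)) 0 w := by
    intro w hw
    have h1 := (hF.1 w).hasDerivAt.mul ((hg w hw).neg.cexp)
    refine h1.congr_deriv ?_
    have := hG' w hw
    field_simp
    ring
  have hexp : ∀ w ∈ Metric.ball (0 : ℂ) R, G w = Q 0 * Complex.exp (g w) := by
    intro w hw
    have := Metric.isOpen_ball.is_const_of_deriv_eq_zero (convex_ball (0 : ℂ) R).isPreconnected
      (fun w hw => (hdiff w hw).differentiableAt.differentiableWithinAt)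
      (fun w hw => (hdiff w hw).deriv) hw (Metric.mem_ball_self hR)
    simp only [hg0, neg_zero, Complex.exp_zero, mul_one, hF.zero] at this
    rw [← this, mul_assoc, ← Complex.exp_add]
    simp
  refine ⟨_, g, hP, fun w hw => ⟨?_, ?_⟩⟩
  · rw [hF.2.2 w, hexp w (by simpa using hw), mul_assoc]
  · refine Complex.borelCaratheodory_zero hm
      (fun w hw => (hg w hw).differentiableAt.differentiableWithinAt) ?_ hR
      (by simpa using hw) hg0
    intro z hz
    have hz' : ‖z‖ < R := by simpa using hz
    have h1 := hF.bound hR hM (w := z) (by linarith)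
    have h2 : ‖G z‖ ≤ ‖Q 0‖ * Real.exp m := by
      refine le_trans ?_ h1
      exact le_mul_of_one_le_right (norm_nonneg _) (one_le_pow₀ one_le_two)
    rw [hexp z hz, norm_mul, Complex.norm_exp] at h2
    have h3 := le_of_mul_le_mul_left h2 (norm_pos_iff.2 h0)
    simpa using Real.exp_le_exp.1 h3

lemma iteratedDeriv_tendsto {F : ℕ → ℂ → ℂ} {f : ℂ → ℂ} {U : Set ℂ} (hU : IsOpen U)
    (hF : ∀ k, Differentiable ℂ (F k)) (h : TendstoLocallyUniformlyOn F f Filter.atTop U) (n : ℕ) :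
    TendstoLocallyUniformlyOn (fun k => iteratedDeriv n (F k)) (iteratedDeriv n f)
      Filter.atTop U := by
  induction n with
  | zero => simpa using h
  | succ n ih =>
    simp only [iteratedDeriv_succ]
    refine ih.deriv (Filter.Eventually.of_forall fun k => ?_) hU
    have : ContDiff ℂ (n + 1 : ℕ) (F k) := (hF k).contDiff
    exact (this.differentiable_iteratedDeriv n (by exact_mod_cast Nat.lt_succ_self n)).differentiableOn

/-- An entire function of growth `exp(o(|w|))`, positive at the origin and with only negative
zeros has nonnegative Taylor coefficients. -/
lemma nncoef_of_negative_zeros {Q : ℂ → ℂ} (hQ : Differentiable ℂ Q) (h0 : 0 < Q 0)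
    (hgrow : ∀ ε : ℝ, 0 < ε → ∃ R, 2 ≤ R ∧ ∀ w, ‖w‖ = 3 * R → ‖Q w‖ ≤ ‖Q 0‖ * Real.exp (ε * R))
    (hz : ∀ w, Q w = 0 → w.im = 0 ∧ w.re < 0) (n : ℕ) : 0 ≤ iteratedDeriv n Q 0 := by
  have hstep : ∀ k : ℕ, ∃ P : ℂ → ℂ, NNCoef P ∧ ∀ w, ‖w‖ < 1 → ∃ g : ℂ,
      Q w = P w * Q 0 * Complex.exp g ∧ ‖g‖ ≤ 4 / (k + 4) := by
    intro k
    obtain ⟨R, hR, h⟩ := hgrow (1 / (k + 4)) (by positivity)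
    obtain ⟨P, g, hP, hPg⟩ := approx_one (R := R) (m := 1 / (k + 4) * R) (by linarith)
      (by positivity) hQ h0.ne' h hz
    refine ⟨P, hP, fun w hw => ⟨g w, (hPg w (by linarith)).1, ?_⟩⟩
    refine (hPg w (by linarith)).2.trans ?_
    have hk : (0 : ℝ) < k + 4 := by positivity
    rw [div_le_div_iff₀ (by linarith) hk]
    have e : 2 * (1 / ((k : ℝ) + 4) * R) * ‖w‖ * (k + 4) = 2 * R * ‖w‖ := by field_simp
    rw [e]
    nlinarith [norm_nonneg w]
  choose P hP hPw using hstep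
  have hA : ∀ k, NNCoef (fun w => P k w * Q 0) := fun k => (hP k).mul (NNCoef.const h0.le)
  have hunif : TendstoUniformlyOn (fun k w => P k w * Q 0) Q Filter.atTop (Metric.ball 0 1) := by
    obtain ⟨B, hB⟩ := (isCompact_closedBall (0 : ℂ) 1).exists_bound_of_continuousOn
      hQ.continuous.continuousOn
    have hlim : Filter.Tendsto (fun k : ℕ => B * (2 * (4 / ((k : ℝ) + 4)))) Filter.atTop (nhds 0) := by
      have h1 : Filter.Tendsto (fun k : ℕ => (4 : ℝ) / ((k : ℝ) + 4)) Filter.atTop (nhds 0) :=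
        Filter.Tendsto.div_atTop tendsto_const_nhds
          (Filter.tendsto_atTop_add_const_right _ _ tendsto_natCast_atTop_atTop)
      simpa using (h1.const_mul 2).const_mul B
    rw [Metric.tendstoUniformlyOn_iff]
    intro ε hε
    filter_upwards [hlim.eventually_lt_const hε] with k hk w hw
    refine lt_of_le_of_lt ?_ hk
    have hw' : ‖w‖ < 1 := by simpa using hw
    obtain ⟨g, h1, h2⟩ := hPw k w hw'
    have h3 : P k w * Q 0 = Q w * Complex.exp (-g) := by
      rw [h1, mul_assoc _ (Complex.exp g), ← Complex.exp_add]; simp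
    have h5 : (4 : ℝ) / (k + 4) ≤ 1 := by
      rw [div_le_one (by positivity)]
      have : (0 : ℝ) ≤ k := Nat.cast_nonneg k
      linarith
    have h4 := Complex.norm_exp_sub_one_le (x := -g) (by rw [norm_neg]; linarith)
    rw [norm_neg] at h4
    have hBw := hB w (by simpa using hw'.le)
    rw [dist_comm, dist_eq_norm, h3, show Q w * Complex.exp (-g) - Q w
      = Q w * (Complex.exp (-g) - 1) by ring, norm_mul]
    gcongr
    · exact (norm_nonneg _).trans hBw
    · linarith
  have hl := iteratedDeriv_tendsto Metric.isOpen_ball (fun k => (hA k).1)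
    hunif.tendstoLocallyUniformlyOn n
  have ht := hl.tendsto_at (Metric.mem_ball_self one_pos)
  exact ge_of_tendsto' ht fun k => (hA k).2 n

end PartD

section PartE

open ComplexOrder

/-! ### Part 5: real zeros versus nonnegative Laguerre expressions -/

lemma lagH_taylor (x : ℂ) (m : ℕ) :
    iteratedDeriv m (fun y => fourierPhi (x + Complex.I * y) * fourierPhi (x + -Complex.I * y)) 0
    = ∑ j ∈ Finset.range (m + 1), (m.choose j : ℂ) *
      (Complex.I ^ j * iteratedDeriv j fourierPhi x) *
      ((-Complex.I) ^ (m - j) * iteratedDeriv (m - j) fourierPhi x) := by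
  have hd := fourierPhi_differentiable
  have key : ∀ (c : ℂ) (j : ℕ), iteratedDeriv j (fun y => fourierPhi (x + c * y)) 0
      = c ^ j * iteratedDeriv j fourierPhi x := by
    intro c j
    have hd2 : Differentiable ℂ (fun z => fourierPhi (x + z)) := by fun_prop
    rw [iteratedDeriv_comp_const_mul (f := fun z => fourierPhi (x + z)) hd2.contDiff c,
      iteratedDeriv_comp_const_add]
    simp
  have hc : ∀ c : ℂ, Differentiable ℂ (fun y => fourierPhi (x + c * y)) := fun c => by fun_prop
  rw [iteratedDeriv_fun_mul (hc _).contDiff.contDiffAt (hc _).contDiff.contDiffAt]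
  simp only [key]

lemma hasSum_Lag (x y : ℂ) : HasSum (fun n => Lag fourierPhi n x * y ^ (2 * n))
    (fourierPhi (x + Complex.I * y) * fourierPhi (x + -Complex.I * y)) := by
  set h : ℂ → ℂ := fun y => fourierPhi (x + Complex.I * y) * fourierPhi (x + -Complex.I * y) with hh
  have hd := fourierPhi_differentiable
  have hdh : Differentiable ℂ h := by rw [hh]; fun_prop
  have hs := Complex.hasSum_taylorSeries_of_entire hdh 0 y
  have hodd : ∀ m, Odd m → iteratedDeriv m h 0 = 0 := by
    intro m hm
    have h1 := iteratedDeriv_comp_neg m h 0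
    have h2 : (fun y => h (-y)) = h := by
      ext y
      simp only [hh]
      rw [mul_comm]
      congr 2 <;> ring
    rw [h2, hm.neg_one_pow, neg_zero, neg_smul, one_smul] at h1
    exact self_eq_neg.1 h1
  have hi : Function.Injective (fun n : ℕ => 2 * n) := fun a b hab => by simpa using hab
  rw [← hi.hasSum_iff] at hs
  · convert! hs using 1
    ext n
    simp only [Function.comp, sub_zero, smul_eq_mul]
    rw [hh, lagH_taylor, Finset.mul_sum, Finset.mul_sum]
    unfold Lag
    rw [Finset.sum_mul]
    refine Finset.sum_congr rfl fun j hj => ?_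
    have hj' : j + (2 * n - j) = 2 * n := by have := Finset.mem_range.1 hj; omega
    have e : Complex.I ^ j * (-Complex.I) ^ (2 * n - j) = (-1) ^ (j + n) := by
      have e1 : Complex.I = (-1) * (-Complex.I) := by ring
      calc Complex.I ^ j * (-Complex.I) ^ (2 * n - j)
          = (-1) ^ j * ((-Complex.I) ^ j * (-Complex.I) ^ (2 * n - j)) := by
            conv_lhs => rw [e1, mul_pow]
            simp [mul_assoc]
        _ = _ := by rw [← pow_add, hj', pow_mul, neg_sq, Complex.I_sq, pow_add]
    rw [← e]
    ring
  · intro m hm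
    have : Odd m := by
      rw [← Nat.not_even_iff_odd]
      rintro ⟨k, hk⟩
      exact hm ⟨k, by simp; omega⟩
    rw [hodd m this]
    simp

lemma Lag_real (n : ℕ) (x : ℝ) : Lag fourierPhi n x = ((Lag fourierPhi n x).re : ℂ) := by
  rw [Lag_eq, Complex.ofReal_re]

lemma realZeros_of_Lag (h : ∀ (n : ℕ) (x : ℝ), 0 ≤ (Lag fourierPhi n x).re) (z : ℂ)
    (hz : fourierPhi z = 0) : z.im = 0 := by
  by_contra hb
  have hd := fourierPhi_differentiable
  have hs := hasSum_Lag z.re z.im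
  rw [show (z.re : ℂ) + Complex.I * z.im = z by
    rw [mul_comm]; exact Complex.re_add_im z, hz, zero_mul] at hs
  have hs2 : HasSum (fun n => (Lag fourierPhi n z.re).re * z.im ^ (2 * n)) 0 := by
    have := Complex.hasSum_re hs
    simp only [Complex.zero_re] at this
    convert! this using 2 with n
    rw [Lag_real, ← Complex.ofReal_pow, ← Complex.ofReal_mul, Complex.ofReal_re, Complex.ofReal_re]
  have hp : ∀ n, 0 ≤ (Lag fourierPhi n z.re).re * z.im ^ (2 * n) := fun n =>
    mul_nonneg (h n _) (by rw [pow_mul]; positivity)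
  have h0 := (hasSum_zero_iff_of_nonneg hp).1 hs2
  have hL : ∀ n, Lag fourierPhi n z.re = 0 := by
    intro n
    have h1 : (Lag fourierPhi n z.re).re * z.im ^ (2 * n) = 0 := congrFun h0 n
    have h2 : (Lag fourierPhi n z.re).re = 0 := by
      rcases mul_eq_zero.1 h1 with h | h
      · exact h
      · exact absurd h (pow_ne_zero _ hb)
    rw [Lag_real, h2]; simp
  have hall : ∀ y : ℂ, fourierPhi (z.re + Complex.I * y) * fourierPhi (z.re + -Complex.I * y) = 0 := by
    intro y
    have := hasSum_Lag z.re y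
    simp only [hL, zero_mul] at this
    exact this.unique hasSum_zero
  have hc : ∀ c : ℂ, AnalyticOnNhd ℂ (fun y => fourierPhi (z.re + c * y)) Set.univ := fun c => by
    have : Differentiable ℂ (fun y => fourierPhi (z.re + c * y)) := by fun_prop
    exact fun w _ => this.analyticAt w
  have := AnalyticOnNhd.eq_zero_or_eq_zero_of_smul_eq_zero (hc Complex.I) (hc (-Complex.I))
    (fun y _ => by simpa using hall y) isPreconnected_univ
  rcases this with h | h
  · have := h (Complex.I * z.re) (Set.mem_univ _)
    simp only [← mul_assoc, Complex.I_mul_I] at this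
    apply fourierPhi_zero_ne
    convert this using 2
    ring
  · have := h (-Complex.I * z.re) (Set.mem_univ _)
    simp only [← mul_assoc, neg_mul_neg, Complex.I_mul_I] at this
    apply fourierPhi_zero_ne
    convert this using 2
    ring

lemma hasSum_LagQ (x w : ℂ) : ∃ y : ℂ, y ^ 2 = w ∧ HasSum (fun n => Lag fourierPhi n x * w ^ n)
    (fourierPhi (x + Complex.I * y) * fourierPhi (x + -Complex.I * y)) := by
  obtain ⟨y, hy⟩ := IsAlgClosed.exists_pow_nat_eq w two_pos
  refine ⟨y, hy, ?_⟩
  have := hasSum_Lag x y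
  simpa only [pow_mul, hy] using this

noncomputable def lagQ (x : ℂ) (w : ℂ) : ℂ := ∑' n, Lag fourierPhi n x * w ^ n

lemma lagQ_eq (x w : ℂ) : ∃ y : ℂ, y ^ 2 = w ∧
    lagQ x w = fourierPhi (x + Complex.I * y) * fourierPhi (x + -Complex.I * y) := by
  obtain ⟨y, hy, h⟩ := hasSum_LagQ x w
  exact ⟨y, hy, h.tsum_eq⟩

lemma lagQ_fps (x : ℂ) : HasFPowerSeriesOnBall (lagQ x)
    (FormalMultilinearSeries.ofScalars ℂ (fun n => Lag fourierPhi n x)) 0 ⊤ := by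
  set p := FormalMultilinearSeries.ofScalars ℂ (fun n => Lag fourierPhi n x) with hp
  have hr : p.radius = ⊤ := by
    apply FormalMultilinearSeries.radius_eq_top_of_summable_norm
    intro r
    obtain ⟨y, -, h⟩ := hasSum_LagQ x ((r : ℝ) : ℂ)
    refine h.summable.norm.congr fun n => ?_
    rw [hp, FormalMultilinearSeries.ofScalars_norm]
    simp
  have := p.hasFPowerSeriesOnBall (by rw [hr]; simp)
  rw [hr] at this
  convert! this using 1
  ext w
  simp [lagQ, FormalMultilinearSeries.sum, hp, mul_comm]

lemma lagQ_diff (x : ℂ) : Differentiable ℂ (lagQ x) := by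
  have := (lagQ_fps x).differentiableOn
  rw [← differentiableOn_univ]
  simpa using this

lemma lagQ_iter (x : ℂ) (n : ℕ) :
    iteratedDeriv n (lagQ x) 0 = n.factorial * Lag fourierPhi n x := by
  have := (lagQ_fps x).factorial_smul 1 n
  rw [iteratedDeriv_eq_iteratedFDeriv, ← this]
  simp [FormalMultilinearSeries.ofScalars_apply_eq]

lemma fourierPhi_real (x : ℝ) : fourierPhi x = ((fourierPhi x).re : ℂ) := by
  have := fourierPhi_conj x
  rw [Complex.conj_ofReal] at this
  exact (Complex.conj_eq_iff_re.1 this.symm).symm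

lemma Lag_nonneg_aux (h : ∀ z, fourierPhi z = 0 → z.im = 0) (n : ℕ) (x : ℝ)
    (hx : fourierPhi x ≠ 0) : 0 ≤ (Lag fourierPhi n x).re := by
  have hQ0 : lagQ x 0 = (((fourierPhi x).re ^ 2 : ℝ) : ℂ) := by
    obtain ⟨y, hy, h⟩ := lagQ_eq x 0
    have : y = 0 := by simpa using hy
    rw [h, this]
    simp only [mul_zero, add_zero]
    rw [fourierPhi_real]
    push_cast
    simp
    ring
  have hre : (fourierPhi x).re ≠ 0 := by
    intro h0
    rw [fourierPhi_real, h0] at hx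
    simp at hx
  have hpos : 0 < lagQ x 0 := by
    rw [hQ0, Complex.zero_lt_real]
    positivity
  have hzero : ∀ w, lagQ x w = 0 → w.im = 0 ∧ w.re < 0 := by
    intro w hw
    obtain ⟨y, hy, hQ⟩ := lagQ_eq x w
    have hyre : y.re = 0 := by
      rw [hw, eq_comm, mul_eq_zero] at hQ
      rcases hQ with h1 | h1
      · simpa using h _ h1
      · simpa using h _ h1
    have hw2 : w = ((-(y.im ^ 2) : ℝ) : ℂ) := by
      rw [← hy, ← Complex.re_add_im y, hyre]
      push_cast
      simp [mul_pow]
    have hw0 : w ≠ 0 := by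
      rintro rfl
      exact hpos.ne' hw
    have hi : y.im ≠ 0 := by
      intro h0
      apply hw0
      rw [hw2, h0]; simp
    rw [hw2]
    refine ⟨Complex.ofReal_im _, ?_⟩
    rw [Complex.ofReal_re]
    have : 0 < y.im ^ 2 := by positivity
    linarith
  have hgrow : ∀ ε : ℝ, 0 < ε → ∃ R, 2 ≤ R ∧ ∀ w, ‖w‖ = 3 * R →
      ‖lagQ x w‖ ≤ ‖lagQ x 0‖ * Real.exp (ε * R) := by
    intro ε hε
    obtain ⟨C, hC, hF⟩ := fourierPhi_growth (ε := ε / 24) (by positivity)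
    have hn : 0 < ‖lagQ x 0‖ := norm_pos_iff.2 hpos.ne'
    have ht : Filter.Tendsto (fun R : ℝ => Real.exp (ε / 2 * R)) Filter.atTop Filter.atTop :=
      Real.tendsto_exp_atTop.comp (Filter.tendsto_id.const_mul_atTop (by positivity))
    obtain ⟨R, hR2, hR⟩ := ((Filter.eventually_ge_atTop (2 : ℝ)).and
      (ht.eventually_ge_atTop (C ^ 2 * Real.exp (ε / 6 * x ^ 2) / ‖lagQ x 0‖))).exists
    refine ⟨R, hR2, fun w hw => ?_⟩
    rw [div_le_iff₀ hn] at hR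
    obtain ⟨y, hy, hQ⟩ := lagQ_eq x w
    have hyn : ‖y‖ ^ 2 = 3 * R := by rw [← norm_pow, hy, hw]
    have hb : ∀ c : ℂ, ‖c‖ = 1 → ‖fourierPhi (x + c * y)‖
        ≤ C * Real.exp (ε / 12 * (x ^ 2 + 3 * R)) := by
      intro c hc
      refine (hF _).trans ?_
      refine mul_le_mul_of_nonneg_left (Real.exp_le_exp.2 ?_) hC.le
      have h1 : ‖(x : ℂ) + c * y‖ ≤ |x| + ‖y‖ := by
        refine (norm_add_le _ _).trans ?_
        rw [norm_mul, hc, one_mul, Complex.norm_real, Real.norm_eq_abs]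
      have h2 : ‖(x : ℂ) + c * y‖ ^ 2 ≤ 2 * (x ^ 2 + 3 * R) := by
        calc _ ≤ (|x| + ‖y‖) ^ 2 := by gcongr
          _ ≤ 2 * (|x| ^ 2 + ‖y‖ ^ 2) := by nlinarith [sq_nonneg (|x| - ‖y‖)]
          _ = _ := by rw [sq_abs, hyn]
      nlinarith
    rw [hQ, norm_mul]
    calc _ ≤ (C * Real.exp (ε / 12 * (x ^ 2 + 3 * R))) *
          (C * Real.exp (ε / 12 * (x ^ 2 + 3 * R))) := by
          gcongr
          · exact hb _ (by simp)
          · exact hb _ (by simp)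
      _ = (C ^ 2 * Real.exp (ε / 6 * x ^ 2)) * Real.exp (ε / 2 * R) := by
          have e : Real.exp (ε / 12 * (x ^ 2 + 3 * R)) * Real.exp (ε / 12 * (x ^ 2 + 3 * R))
            = Real.exp (ε / 6 * x ^ 2) * Real.exp (ε / 2 * R) := by
            rw [← Real.exp_add, ← Real.exp_add]; congr 1; ring
          rw [mul_mul_mul_comm, e]; ring
      _ ≤ (Real.exp (ε / 2 * R) * ‖lagQ x 0‖) * Real.exp (ε / 2 * R) := by gcongr
      _ = _ := by
          rw [mul_comm (Real.exp _) ‖lagQ x 0‖, mul_assoc, ← Real.exp_add]; congr 2; ring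
  have hfin := nncoef_of_negative_zeros (lagQ_diff x) hpos hgrow hzero n
  rw [lagQ_iter, Lag_real, ← Complex.ofReal_natCast, ← Complex.ofReal_mul,
    Complex.zero_le_real] at hfin
  exact nonneg_of_mul_nonneg_right hfin (by positivity)

lemma Lag_nonneg (h : ∀ z, fourierPhi z = 0 → z.im = 0) (n : ℕ) (x : ℝ) :
    0 ≤ (Lag fourierPhi n x).re := by
  have hcont : Continuous fun x : ℝ => (Lag fourierPhi n x).re := by
    unfold Lag
    have := iteratedDeriv_fourierPhi_continuous
    fun_prop
  have hd := fourierPhi_differentiable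
  have hfreq : ∃ᶠ y in nhds x, fourierPhi (y : ℝ) ≠ 0 := by
    by_contra hcon
    rw [Filter.not_frequently] at hcon
    push Not at hcon
    have han : AnalyticOnNhd ℂ fourierPhi Set.univ := fun w _ => hd.analyticAt w
    have h1 : ∃ᶠ z in nhdsWithin (x : ℂ) {(x : ℂ)}ᶜ, fourierPhi z = 0 := by
      have ht : Filter.Tendsto (fun y : ℝ => (y : ℂ)) (nhdsWithin x {x}ᶜ)
          (nhdsWithin (x : ℂ) {(x : ℂ)}ᶜ) := by
        refine tendsto_nhdsWithin_of_tendsto_nhds_of_eventually_within _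
          (Complex.continuous_ofReal.tendsto x |>.mono_left nhdsWithin_le_nhds) ?_
        filter_upwards [self_mem_nhdsWithin] with y hy
        simpa using hy
      exact ht.frequently ((hcon.filter_mono nhdsWithin_le_nhds).frequently)
    have := han.eqOn_zero_of_preconnected_of_frequently_eq_zero isPreconnected_univ
      (Set.mem_univ _) h1
    exact fourierPhi_zero_ne (this (Set.mem_univ 0))
  by_contra hneg
  push Not at hneg
  obtain ⟨y, hy1, hy2⟩ := (hfreq.and_eventually (hcont.continuousAt.eventually_lt_const hneg)).exists
  exact absurd (Lag_nonneg_aux h n y hy1) (not_le.2 hy2)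

end PartE

section PartF

open MeasureTheory
open ComplexOrder

lemma gauss_integrable {g : ℝ → ℝ} (hi : Integrable g) {v : NNReal} (hv : v ≠ 0) :
    Integrable g (ProbabilityTheory.gaussianReal 0 v) := by
  rw [ProbabilityTheory.gaussianReal_of_var_ne_zero _ hv,
    integrable_withDensity_iff_integrable_smul' (ProbabilityTheory.measurable_gaussianPDF _ _)
      (Filter.Eventually.of_forall fun _ => ProbabilityTheory.gaussianPDF_lt_top)]
  simp only [ProbabilityTheory.toReal_gaussianPDF, smul_eq_mul]
  refine hi.bdd_mul (c := (Real.sqrt (2 * Real.pi * v))⁻¹)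
    (ProbabilityTheory.stronglyMeasurable_gaussianPDFReal _ _).aestronglyMeasurable
    (Filter.Eventually.of_forall fun x => ?_)
  rw [Real.norm_of_nonneg (ProbabilityTheory.gaussianPDFReal_nonneg _ _ _),
    ProbabilityTheory.gaussianPDFReal]
  refine mul_le_of_le_one_right (by positivity) ?_
  rw [Real.exp_le_one_iff]
  apply div_nonpos_of_nonpos_of_nonneg
  · linarith [sq_nonneg (x - 0)]
  · positivity

lemma gauss_avg {g : ℝ → ℝ} (hi : Integrable g)
    (hg : ∀ (N : ℕ) (x : Fin N → ℝ), 0 ≤ ∑ j, ∑ k, g (x j - x k)) {v : NNReal} (hv : v ≠ 0) :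
    0 ≤ ∫ u, g u ∂(ProbabilityTheory.gaussianReal 0 (v + v)) := by
  set I := ∫ u, g u ∂(ProbabilityTheory.gaussianReal 0 (v + v)) with hI
  have hvv : v + v ≠ 0 := by
    intro h
    exact hv (by simpa using h)
  have key : ∀ N : ℕ, 0 ≤ (N + 1 : ℝ) * (g 0 + N * I) := by
    intro N
    let P : Measure (Fin (N + 1) → ℝ) :=
      Measure.pi fun _ => ProbabilityTheory.gaussianReal 0 v
    have hlaw : ∀ j k : Fin (N + 1), j ≠ k →
        P.map (fun x => x j - x k) = ProbabilityTheory.gaussianReal 0 (v + v) := by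
      intro j k hjk
      have h1 : ProbabilityTheory.iIndepFun
          (fun (i : Fin (N + 1)) (ω : Fin (N + 1) → ℝ) => ω i) P :=
        ProbabilityTheory.iIndepFun_pi (X := fun _ => id) (fun _ => aemeasurable_id)
      have h2 := h1.indepFun hjk
      have h3 := h2.comp measurable_id (measurable_neg (G := ℝ))
      have e1 : P.map (fun x => x j) = ProbabilityTheory.gaussianReal 0 v :=
        (measurePreserving_eval (fun _ : Fin (N + 1) => ProbabilityTheory.gaussianReal 0 v) j).map_eq
      have e2 : P.map (fun x => x k) = ProbabilityTheory.gaussianReal 0 v :=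
        (measurePreserving_eval (fun _ : Fin (N + 1) => ProbabilityTheory.gaussianReal 0 v) k).map_eq
      have e3 : P.map (Neg.neg ∘ fun x => x k) = ProbabilityTheory.gaussianReal 0 v := by
        have e4 := Measure.map_map (μ := P) (g := (Neg.neg : ℝ → ℝ)) (f := fun x => x k)
          measurable_neg (measurable_pi_apply k)
        rw [← e4, e2]
        simpa using ProbabilityTheory.gaussianReal_map_neg (μ := 0) (v := v)
      have := ProbabilityTheory.gaussianReal_add_gaussianReal_of_indepFun h3 e1 e3
      rw [add_zero] at this
      rw [← this]
      congr 1
    have hmeas : ∀ j k : Fin (N + 1), Measurable (fun x : Fin (N + 1) → ℝ => x j - x k) :=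
      fun j k => (measurable_pi_apply j).sub (measurable_pi_apply k)
    have hIntg : ∀ j k : Fin (N + 1), Integrable (fun x => g (x j - x k)) P := by
      intro j k
      by_cases hjk : j = k
      · subst hjk
        simp only [sub_self]
        exact integrable_const _
      · have := gauss_integrable hi hvv
        rw [← hlaw j k hjk] at this
        exact this.comp_measurable (hmeas j k)
    have hval : ∀ j k : Fin (N + 1), ∫ x, g (x j - x k) ∂P = if j = k then g 0 else I := by
      intro j k
      split_ifs with hjk
      · subst hjk
        simp [P]
      · rw [hI, ← hlaw j k hjk, integral_map (hmeas j k).aemeasurable]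
        rw [hlaw j k hjk]
        exact (gauss_integrable hi hvv).aestronglyMeasurable
    have h0 : 0 ≤ ∫ x, ∑ j, ∑ k, g (x j - x k) ∂P := integral_nonneg fun x => hg _ x
    rw [integral_finsetSum _ fun j _ => integrable_finsetSum _ fun k _ => hIntg j k] at h0
    have h1 : ∀ j : Fin (N + 1), ∫ x, ∑ k, g (x j - x k) ∂P = g 0 + N * I := by
      intro j
      rw [integral_finsetSum _ fun k _ => hIntg j k]
      simp only [hval]
      rw [← Finset.add_sum_erase _ _ (Finset.mem_univ j)]
      rw [Finset.sum_congr rfl (g := fun _ => I)]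
      · simp
      · intro k hk
        rw [if_neg (Finset.ne_of_mem_erase hk).symm]
    simp only [h1] at h0
    rw [Finset.sum_const, Finset.card_univ, Fintype.card_fin, nsmul_eq_mul] at h0
    exact_mod_cast h0
  by_contra hneg
  push Not at hneg
  obtain ⟨N, hN⟩ := exists_nat_gt (g 0 / (-I))
  rw [div_lt_iff₀ (by linarith)] at hN
  have := key N
  have h2 : 0 ≤ g 0 + N * I := nonneg_of_mul_nonneg_right this (by positivity)
  linarith

lemma integral_nonneg_of_form {g : ℝ → ℝ} (hi : Integrable g)
    (hg : ∀ (N : ℕ) (x : Fin N → ℝ), 0 ≤ ∑ j, ∑ k, g (x j - x k)) : 0 ≤ ∫ u, g u := by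
  have h1 : ∀ c : ℝ, 0 < c → 0 ≤ ∫ u, Real.exp (-c⁻¹ * u ^ 2) * g u := by
    intro c hc
    obtain ⟨v, hv⟩ : ∃ v : NNReal, (v : ℝ) = c / 4 := ⟨⟨c / 4, by positivity⟩, rfl⟩
    have hv0 : v ≠ 0 := by
      intro h
      have := congrArg NNReal.toReal h
      rw [hv, NNReal.coe_zero] at this
      linarith
    have h := gauss_avg hi hg hv0
    rw [ProbabilityTheory.integral_gaussianReal_eq_integral_smul (by simpa using hv0)] at h
    simp only [ProbabilityTheory.gaussianPDFReal, smul_eq_mul, mul_assoc] at h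
    rw [integral_const_mul] at h
    have hp : 0 < (Real.sqrt (2 * (Real.pi * ((v + v : NNReal) : ℝ))))⁻¹ := by
      have : (0 : ℝ) < ((v + v : NNReal) : ℝ) := by
        rw [NNReal.coe_add, hv]; linarith
      positivity
    have h := nonneg_of_mul_nonneg_right h hp
    refine h.trans_eq ?_
    congr 1 with u
    congr 2
    rw [NNReal.coe_add]
    simp only [hv, sub_zero]
    field_simp
    ring
  have h2 := Real.tendsto_integral_cexp_sq_smul (V := ℝ) (f := fun u => (g u : ℂ)) hi.ofReal
  have h3 : (0 : ℂ) ≤ ∫ u, (g u : ℂ) := by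
    refine ge_of_tendsto h2 ?_
    filter_upwards [Filter.Ioi_mem_atTop (0 : ℝ)] with c hc
    have := h1 c hc
    have e : ∫ u : ℝ, Complex.exp (-(c : ℂ)⁻¹ * (‖u‖ : ℂ) ^ 2) • (g u : ℂ) =
        ((∫ u, Real.exp (-c⁻¹ * u ^ 2) * g u : ℝ) : ℂ) := by
      rw [← integral_complex_ofReal]
      congr 1 with u
      rw [smul_eq_mul, ← Complex.ofReal_pow, Real.norm_eq_abs, sq_abs]
      push_cast
      rfl
    push_cast at e ⊢
    rw [e]
    exact_mod_cast this
  rw [integral_complex_ofReal] at h3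
  exact_mod_cast h3

lemma ft_nonneg_of_posDef {K : ℝ → ℝ} (hi : Integrable K) (hK : PosDefKernel K) (x : ℝ) :
    0 ≤ ∫ t, K t * Real.cos (2 * x * t) := by
  apply integral_nonneg_of_form
  · refine hi.mul_bdd (c := 1) (by fun_prop) (Filter.Eventually.of_forall fun t => ?_)
    exact Real.abs_cos_le_one _
  intro N y
  have h := hK.2 N y (fun j => Complex.exp ((2 * x * y j : ℝ) * Complex.I))
  have h := (Complex.le_def.1 h).1
  simp only [Complex.zero_re, Complex.re_sum] at h
  refine h.trans_eq (Finset.sum_congr rfl fun j _ => Finset.sum_congr rfl fun k _ => ?_)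
  rw [← Complex.exp_conj, mul_assoc, ← Complex.exp_add, Complex.re_ofReal_mul]
  congr 1
  rw [map_mul, Complex.conj_I, Complex.conj_ofReal]
  rw [show ((2 * x * y j : ℝ) : ℂ) * Complex.I + ((2 * x * y k : ℝ) : ℂ) * -Complex.I =
    ((2 * x * (y j - y k) : ℝ) : ℂ) * Complex.I by push_cast; ring, Complex.exp_ofReal_mul_I_re]

open FourierTransform in
lemma tendsto_gauss_fourier {f : ℝ → ℂ} (hf : Integrable f) (hc : Continuous f) (v : ℝ) :
    Filter.Tendsto (fun c : ℝ => ∫ w : ℝ,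
      Complex.exp (-(c : ℂ)⁻¹ * (w : ℂ) ^ 2 + 2 * Real.pi * Complex.I * (v * w)) * 𝓕 f w)
      Filter.atTop (nhds (f v)) := by
  have h := Real.tendsto_integral_gaussian_smul' hf (v := v) hc.continuousAt
  refine h.congr' ?_
  filter_upwards [Filter.Ioi_mem_atTop (0 : ℝ)] with c hc
  have hc : 0 < c := hc
  have J : Integrable (fun w : ℝ ↦ Complex.exp (- (c : ℂ)⁻¹ * (‖w‖ : ℂ) ^ 2 +
      2 * Real.pi * Complex.I * (inner ℝ v w : ℝ))) :=
    GaussianFourier.integrable_cexp_neg_mul_sq_norm_add (by simpa) _ _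
  have h1 : ∫ w : ℝ, 𝓕 (fun w : ℝ ↦ Complex.exp (- (c : ℂ)⁻¹ * (‖w‖ : ℂ) ^ 2 +
      2 * Real.pi * Complex.I * (inner ℝ v w : ℝ))) w • f w =
      ∫ w : ℝ, Complex.exp (- (c : ℂ)⁻¹ * (‖w‖ : ℂ) ^ 2 +
      2 * Real.pi * Complex.I * (inner ℝ v w : ℝ)) • 𝓕 f w := by
    simpa using! (VectorFourier.integral_fourierIntegral_smul_eq_flip (L := innerₗ ℝ)
      Real.continuous_fourierChar continuous_inner J hf)
  have h2 : ∫ w : ℝ, Complex.exp (- (c : ℂ)⁻¹ * (‖w‖ : ℂ) ^ 2 +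
      2 * Real.pi * Complex.I * (inner ℝ v w : ℝ)) • 𝓕 f w = ∫ w : ℝ,
      Complex.exp (-(c : ℂ)⁻¹ * (w : ℂ) ^ 2 + 2 * Real.pi * Complex.I * (v * w)) * 𝓕 f w := by
    congr 1 with w
    rw [smul_eq_mul, ← Complex.ofReal_pow, Real.norm_eq_abs, sq_abs]
    simp [mul_comm]
  rw [← h2, ← h1]
  congr with w
  rw [fourier_gaussian_innerProductSpace' (by simpa)]
  congr 3
  · simp
  · simp; ring

open FourierTransform in
lemma posDef_of_ft_nonneg {K : ℝ → ℝ} (hi : Integrable K) (hc : Continuous K)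
    (hft : ∀ x : ℝ, (0 : ℂ) ≤ 𝓕 (fun t => (K t : ℂ)) x) : PosDefKernel K := by
  refine ⟨hc, fun N x ρ => ?_⟩
  have hiC : Integrable (fun t => (K t : ℂ)) := hi.ofReal
  have hcC : Continuous (fun t => (K t : ℂ)) := by fun_prop
  set G := 𝓕 (fun t => (K t : ℂ)) with hG
  have hGc : Continuous G := VectorFourier.fourierIntegral_continuous (L := innerₗ ℝ)
    Real.continuous_fourierChar continuous_inner hiC
  have hGb : ∀ w, ‖G w‖ ≤ ∫ t, ‖(K t : ℂ)‖ := fun w => by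
    exact VectorFourier.norm_fourierIntegral_le_integral_norm _ _ _ _ _
  have hlim : Filter.Tendsto (fun c : ℝ => ∑ j, ∑ k, (∫ w : ℝ,
      Complex.exp (-(c : ℂ)⁻¹ * (w : ℂ) ^ 2 + 2 * Real.pi * Complex.I * ((x j - x k : ℝ) * w)) * G w)
      * ρ j * (starRingEnd ℂ) (ρ k)) Filter.atTop
      (nhds (∑ j, ∑ k, (K (x j - x k) : ℂ) * ρ j * (starRingEnd ℂ) (ρ k))) := by
    refine tendsto_finsetSum _ fun j _ => tendsto_finsetSum _ fun k _ => ?_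
    exact ((tendsto_gauss_fourier hiC hcC (x j - x k)).mul_const _).mul_const _
  refine ge_of_tendsto hlim ?_
  filter_upwards [Filter.Ioi_mem_atTop (0 : ℝ)] with c hc'
  have hc' : 0 < c := hc'
  have hIntg : ∀ v : ℝ, Integrable (fun w : ℝ =>
      Complex.exp (-(c : ℂ)⁻¹ * (w : ℂ) ^ 2 + 2 * Real.pi * Complex.I * (v * w)) * G w) := by
    intro v
    have J : Integrable (fun w : ℝ ↦ Complex.exp (- (c : ℂ)⁻¹ * (‖w‖ : ℂ) ^ 2 +
        2 * Real.pi * Complex.I * (inner ℝ v w : ℝ))) :=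
      GaussianFourier.integrable_cexp_neg_mul_sq_norm_add (by simpa) _ _
    have J2 := J.mul_bdd (g := G) (c := ∫ t, ‖(K t : ℂ)‖) hGc.aestronglyMeasurable
      (Filter.Eventually.of_forall hGb)
    refine J2.congr (Filter.Eventually.of_forall fun w => ?_)
    simp only
    rw [← Complex.ofReal_pow, Real.norm_eq_abs, sq_abs]
    simp [mul_comm]
  have e : ∑ j, ∑ k, (∫ w : ℝ,
      Complex.exp (-(c : ℂ)⁻¹ * (w : ℂ) ^ 2 + 2 * Real.pi * Complex.I * ((x j - x k : ℝ) * w)) * G w)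
      * ρ j * (starRingEnd ℂ) (ρ k) = ∫ w : ℝ, ∑ j, ∑ k,
      (Complex.exp (-(c : ℂ)⁻¹ * (w : ℂ) ^ 2 + 2 * Real.pi * Complex.I * ((x j - x k : ℝ) * w)) * G w)
      * ρ j * (starRingEnd ℂ) (ρ k) := by
    rw [integral_finsetSum _ fun j _ => integrable_finsetSum _ fun k _ =>
      ((hIntg _).mul_const _).mul_const _]
    refine Finset.sum_congr rfl fun j _ => ?_
    rw [integral_finsetSum _ fun k _ => ((hIntg _).mul_const _).mul_const _]
    refine Finset.sum_congr rfl fun k _ => ?_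
    rw [integral_mul_const, integral_mul_const]
  rw [e]
  have hpt : ∀ w : ℝ, ∑ j, ∑ k,
      (Complex.exp (-(c : ℂ)⁻¹ * (w : ℂ) ^ 2 + 2 * Real.pi * Complex.I * ((x j - x k : ℝ) * w)) * G w)
      * ρ j * (starRingEnd ℂ) (ρ k) =
      (((Real.exp (-c⁻¹ * w ^ 2)) * (G w).re * ‖∑ j, Complex.exp ((2 * Real.pi * x j * w : ℝ) *
        Complex.I) * ρ j‖ ^ 2 : ℝ) : ℂ) := by
    intro w
    have hGr : G w = ((G w).re : ℂ) := Complex.ext rfl (by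
      simpa using (Complex.le_def.1 (hft w)).2.symm)
    rw [Complex.ofReal_mul, Complex.ofReal_pow, ← Complex.mul_conj', map_sum, Finset.sum_mul_sum,
      Finset.mul_sum, Complex.ofReal_mul, ← hGr]
    refine Finset.sum_congr rfl fun j _ => ?_
    rw [Finset.mul_sum]
    refine Finset.sum_congr rfl fun k _ => ?_
    rw [map_mul, ← Complex.exp_conj, map_mul, Complex.conj_I, Complex.conj_ofReal, Complex.exp_add,
      show 2 * (Real.pi : ℂ) * Complex.I * ((x j - x k : ℝ) * w) =
        (2 * Real.pi * x j * w : ℝ) * Complex.I + (2 * Real.pi * x k * w : ℝ) * -Complex.I by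
        push_cast; ring, Complex.exp_add]
    push_cast
    ring
  simp only [hpt]
  rw [integral_complex_ofReal]
  have : 0 ≤ ∫ w : ℝ, (Real.exp (-c⁻¹ * w ^ 2)) * (G w).re *
      ‖∑ j, Complex.exp ((2 * Real.pi * x j * w : ℝ) * Complex.I) * ρ j‖ ^ 2 := by
    refine integral_nonneg fun w => ?_
    have := (Complex.le_def.1 (hft w)).1
    exact mul_nonneg (mul_nonneg (Real.exp_pos _).le this) (by positivity)
  exact_mod_cast this

open FourierTransform in
lemma posDef_K (n : ℕ) (h : ∀ x : ℝ, 0 ≤ ∫ t, assocKernelPhi n t * Real.cos (2 * x * t)) :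
    PosDefKernel (assocKernelPhi n) := by
  refine posDef_of_ft_nonneg (K_integrable n) (K_continuous n) fun w => ?_
  have := K_fourier n (-(Real.pi * w))
  rw [Real.fourier_real_eq_integral_exp_smul]
  have e : ∫ t : ℝ, Complex.exp (((-2 * Real.pi * t * w : ℝ) : ℂ) * Complex.I) •
      (assocKernelPhi n t : ℂ) =
      ((∫ t, assocKernelPhi n t * Real.cos (2 * (-(Real.pi * w)) * t) : ℝ) : ℂ) := by
    rw [← this]
    congr 1 with t
    rw [smul_eq_mul, mul_comm]
    congr 2
    push_cast
    ring
  rw [e]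
  exact_mod_cast h _

lemma Lag_re_nonneg_iff (n : ℕ) (x : ℝ) : 0 ≤ (Lag fourierPhi n x).re ↔
    0 ≤ ∫ t, assocKernelPhi n t * Real.cos (2 * x * t) := by
  rw [Lag_eq, Complex.ofReal_re]
  exact mul_nonneg_iff_of_pos_left (by positivity)

end PartF

/-- **Theorem 4.6.** With `F = 2H` the Fourier transform of the Jacobi theta kernel:
`Lₙ(x; F) = (2·2^{2n}/(2n)!)·∫ Kₙ(t; Φ)·cos(2xt) dt` for all `n ∈ ℕ₀`, `x ∈ ℝ`; and
`H` has only real zeros (equivalently, the Riemann Hypothesis holds) if and only if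
`Kₙ(·; Φ)` is a positive definite kernel for every `n ∈ ℕ₀`. -/
theorem thm_4_6 :
    (∀ z : ℂ, fourierPhi z = 2 * xiH z) ∧
    (∀ (n : ℕ) (x : ℝ),
      Lag fourierPhi n (x : ℂ) =
        ((2 * 2 ^ (2 * n) / (Nat.factorial (2 * n)) *
          ∫ t : ℝ, assocKernelPhi n t * Real.cos (2 * x * t) : ℝ) : ℂ)) ∧
    ((∀ z : ℂ, xiH z = 0 → z.im = 0) ↔ ∀ n : ℕ, PosDefKernel (assocKernelPhi n)) := by
  refine ⟨fourierPhi_eq_xiH, Lag_eq, ?_, ?_⟩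
  · intro h n
    refine posDef_K n fun x => (Lag_re_nonneg_iff n x).1 (Lag_nonneg (fun z hz => h z ?_) n x)
    rw [fourierPhi_eq_xiH] at hz
    exact (mul_eq_zero.1 hz).resolve_left two_ne_zero
  · intro h z hz
    refine realZeros_of_Lag (fun n x => (Lag_re_nonneg_iff n x).2
      (ft_nonneg_of_posDef (K_integrable n) (h n) x)) z ?_
    rw [fourierPhi_eq_xiH, hz, mul_zero]
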